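/- arXiv:2508.12203 — 3 statements merged into one kernel-verified Lean document; each statement's English description precedes it below -/
import Mathlib

section
/- Let t ∈ ℂ and let x₁, x₂, x₃, x₄ ∈ SL(2,ℂ) with tr(xᵢ) = t for all i, such that r₁ = r₂ = r₃ = r₄ where rᵢ = xᵢxᵢ₊₁xᵢ⁻¹xᵢ₋₁xᵢ (subscripts modulo 4), each of the triples (x₁,x₂,x₃), (x₁,x₂,x₄), (x₁,x₃,x₄), (x₂,x₃,x₄) is irreducible, tr(xᵢxᵢ₊₁) ≠ 1 for all i (subscripts modulo 4), tr(x₁x₃) ≠ tr(x₂x₄), tr(x₁x₄) = tr(x₁x₂), and tr(x₃x₄) = tr(x₂x₃). Set α = t² − 1 and μ = tr(x₁x₂) + tr(x₂x₃) − 2. Then μ² + (α² − 4α)·μ + 4α² − α³ = 0. -/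
open Matrix

local notation "𝕄" => Matrix (Fin 2) (Fin 2) ℂ
local notation "SL2" => Matrix.SpecialLinearGroup (Fin 2) ℂ

/-- A family of 2×2 complex matrices is irreducible if there is no nonzero vector
`v ∈ ℂ²` which is a common eigenvector of all members. -/
def IsIrreducibleFamily {ι : Type*} (x : ι → Matrix (Fin 2) (Fin 2) ℂ) : Prop :=
  ¬ ∃ v : Fin 2 → ℂ, v ≠ 0 ∧ ∀ i, ∃ a : ℂ, (x i).mulVec v = a • v

set_option linter.unusedSimpArgs false
set_option linter.unusedVariables false

/-- Coordinates of a traceless 2×2 matrix `!![u, v; w, -u]`. -/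
structure V3 where
  u : ℂ
  v : ℂ
  w : ℂ

namespace V3

noncomputable def dot (X Y : V3) : ℂ := -(X.u * Y.u) - (X.v * Y.w + X.w * Y.v) / 2
noncomputable def cu (X Y : V3) : ℂ := (X.v * Y.w - Y.v * X.w) / 2
noncomputable def cv (X Y : V3) : ℂ := X.u * Y.v - X.v * Y.u
noncomputable def cw (X Y : V3) : ℂ := X.w * Y.u - X.u * Y.w
noncomputable def tri (X Y Z : V3) : ℂ := -(X.u * cu Y Z) - (X.v * cw Y Z + X.w * cv Y Z) / 2

end V3

open V3

noncomputable def mat (h : ℂ) (X : V3) : Matrix (Fin 2) (Fin 2) ℂ := !![h + X.u, X.v; X.w, h - X.u]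

noncomputable def cc (h : ℂ) (X Y Z : V3) : ℂ :=
  2 * (h ^ 2 - (dot Y Z * (2 * h ^ 2 - 1) + 2 * h * tri X Y Z + 2 * dot X Y * dot X Z))

noncomputable def rs (h : ℂ) (X Y Z : V3) : ℂ :=
  cc h X Y Z * h - h ^ 3 - h * (dot Z X + dot X Y - dot Z Y) + tri Z X Y
noncomputable def ru (h : ℂ) (X Y Z : V3) : ℂ :=
  cc h X Y Z * X.u - h ^ 2 * (X.u - Z.u - Y.u) + h * (cu Z X + cu X Y + cu Y Z)
    + dot Z X * Y.u - dot Z Y * X.u + dot X Y * Z.u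
noncomputable def rv (h : ℂ) (X Y Z : V3) : ℂ :=
  cc h X Y Z * X.v - h ^ 2 * (X.v - Z.v - Y.v) + h * (cv Z X + cv X Y + cv Y Z)
    + dot Z X * Y.v - dot Z Y * X.v + dot X Y * Z.v
noncomputable def rww (h : ℂ) (X Y Z : V3) : ℂ :=
  cc h X Y Z * X.w - h ^ 2 * (X.w - Z.w - Y.w) + h * (cw Z X + cw X Y + cw Y Z)
    + dot Z X * Y.w - dot Z Y * X.w + dot X Y * Z.w

theorem cayley (x M : Matrix (Fin 2) (Fin 2) ℂ) (hx : x.det = 1) :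
    x * M * x = (x * M).trace • x - M.adjugate := by
  rw [Matrix.det_fin_two] at hx
  ext i j
  fin_cases i <;> fin_cases j <;>
    simp [Matrix.mul_apply, Fin.sum_univ_two, Matrix.trace_fin_two, Matrix.adjugate_fin_two]
  · linear_combination (-M 1 1) * hx
  · linear_combination (M 0 1) * hx
  · linear_combination (M 1 0) * hx
  · linear_combination (-M 0 0) * hx

theorem rform (h : ℂ) (X Y Z : V3) (hX : (mat h X).det = 1) :
    mat h X * mat h Y * (mat h X).adjugate * mat h Z * mat h X
      = !![rs h X Y Z + ru h X Y Z, rv h X Y Z; rww h X Y Z, rs h X Y Z - ru h X Y Z] := by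
  have e : mat h X * mat h Y * (mat h X).adjugate * mat h Z * mat h X
      = mat h X * (mat h Y * (mat h X).adjugate * mat h Z) * mat h X := by
    simp only [Matrix.mul_assoc]
  rw [e, cayley _ _ hX]
  have hc : (mat h X * (mat h Y * (mat h X).adjugate * mat h Z)).trace = cc h X Y Z := by
    rw [mat, Matrix.det_fin_two] at hX
    simp only [mat, Matrix.adjugate_fin_two_of, Matrix.trace_fin_two, Matrix.mul_apply, Fin.sum_univ_two, cc, dot, tri,
      cu, cv, cw, Matrix.of_apply, Matrix.cons_val', Matrix.cons_val_zero, Matrix.cons_val_one, Matrix.cons_val_fin_one] at hX ⊢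
    linear_combination (2 * (h ^ 2 + (-(Y.u * Z.u) - (Y.v * Z.w + Y.w * Z.v) / 2))) * hX
  rw [hc]
  simp only [rs, ru, rv, rww]
  generalize cc h X Y Z = c
  ext i j
  fin_cases i <;> fin_cases j <;>
    simp [mat, Matrix.adjugate_fin_two, Matrix.mul_apply, Fin.sum_univ_two, dot, tri, cu, cv, cw] <;> ring

theorem alg_p1 (O1 O3 OU p q a b T : ℂ)
    (h0 :  - 2*O3*T + 6*O3 - 4*OU*a + 2*OU*T - 2*OU + 2*p*a*T - 4*p*a - 1*p*T^2 + 3*p*T -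
      1*q*T^2 + 5*q*T - 4*q - 4*a^2*b + 4*a^2*T - 4*a^2 + 4*a*b*T - 5*a*T^2 + 5*a*T - 1*b*T^2 -
      1*b*T + 4*b + 2*T^3 - 4*T^2 = 0)
    (h1 :  - 4*O1*p + 2*O1*T + 2*O3 - 4*OU*a + 2*OU*T + 2*OU - 2*p*q*T + 2*p*q + 2*p*a*T -
      4*p*a + 4*p*b^2 - 4*p*b*T + 1*p*T^2 + 1*p*T + 1*q*T^2 - 1*q*T - 4*a^2*b + 2*a^2*T +
      4*a*b*T + 4*a*b - 3*a*T^2 - 1*a*T - 2*b^2*T + 1*b*T^2 - 3*b*T + 4*b + 2*T^2 - 4*T = 0)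
    (h2 : 2*O1 - 4*O3*p + 2*O3*T - 4*OU*b + 2*OU*T + 2*OU - 2*p*q*T + 2*p*q + 4*p*a^2 - 4*p*a*T
      + 2*p*b*T - 4*p*b + 1*p*T^2 + 1*p*T + 1*q*T^2 - 1*q*T - 2*a^2*T - 4*a*b^2 + 4*a*b*T +
      4*a*b + 1*a*T^2 - 3*a*T + 4*a + 2*b^2*T - 3*b*T^2 - 1*b*T + 2*T^2 - 4*T = 0)
    (h3 :  - 2*O1*T + 6*O1 - 4*OU*b + 2*OU*T - 2*OU + 2*p*b*T - 4*p*b - 1*p*T^2 + 3*p*T -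
      1*q*T^2 + 5*q*T - 4*q - 4*a*b^2 + 4*a*b*T - 1*a*T^2 - 1*a*T + 4*a + 4*b^2*T - 4*b^2 -
      5*b*T^2 + 5*b*T + 2*T^3 - 4*T^2 = 0)
    (h4 : 1*O1 - 4*O3*a + 2*O3*T - 1*O3 - 2*OU*q + 4*OU + 1*p*q*T - 1*p*q - 2*p*T + 2*p -
      2*q*a*b - 1*q*a*T + 4*q*a + 1*q*b*T - 2*q*T + 4*a^3 - 6*a^2*T + 4*a*T^2 - 1*a*T - 4*a +
      1*b*T - 1*T^3 + 1*T^2 + 2*T = 0)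
    (h5 :  - 4*O1*b + 2*O1*T - 1*O1 + 1*O3 - 2*OU*q + 4*OU + 1*p*q*T - 1*p*q - 2*p*T + 2*p -
      2*q*a*b + 1*q*a*T - 1*q*b*T + 4*q*b - 2*q*T + 1*a*T + 4*b^3 - 6*b^2*T + 4*b*T^2 - 1*b*T -
      4*b - 1*T^3 + 1*T^2 + 2*T = 0)
    (h6 :  - 1*O1*T + 1*O1 + 1*O3*T - 1*O3 - 1*a^2*T + 1*a*T^2 + 1*a*T + 1*b^2*T - 1*b*T^2 -
      1*b*T = 0)
    (h7 : 2*O3*T - 2*O3 + 2*OU*T - 2*OU - 1*p*T^2 + 3*p*T + 1*q*T^2 - 3*q*T - 2*a^2*T + 2*a*b*T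
      + 1*a*T^2 + 1*a*T - 1*b*T^2 - 1*b*T = 0)
    (h8 : 1*O1 + 1*O3 - 2*OU*q + 2*OU*T - 2*OU + 1*p*q*T - 1*p*q - 1*p*T^2 + 3*p*T - 2*p -
      2*q*a*b + 1*q*a*T + 1*q*b*T - 1*q*T^2 + 1*q*T + 2*a*b*T - 4*a*b - 1*a*T^2 + 2*a*T -
      1*b*T^2 + 2*b*T + 1*T^3 - 3*T^2 + 2*T = 0) :
    (p - 1) * (a - b) = 0 := by
  linear_combination
      (1/8*p*b - 1/8*p - 1/8*q*T - 1/8*a*b + 1/8*a*T + 1/8*a - 1/8*b*T + 1/8*b + 1/8*T^2 -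
        1/4*T + 1/8) * h0 + (1/8*q*T - 1/8*q - 1/8*a*b - 1/8*a - 1/4*b^2 + 1/2*b*T - 1/4*b -
        1/4*T^2 + 1/4*T + 1/4) * h1 + ( - 1/8*q*T + 1/8*q + 1/4*a^2 + 1/8*a*b - 1/2*a*T + 1/4*a
        + 1/8*b + 1/4*T^2 - 1/4*T - 1/4) * h2 + ( - 1/8*p*a + 1/8*p + 1/8*q*T + 1/8*a*b +
        1/8*a*T - 1/8*a - 1/8*b*T - 1/8*b - 1/8*T^2 + 1/4*T - 1/8) * h3 + ( - 1/4*p*a - 1/8*p*b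
        + 1/2*p*T - 1/4*p + 1/8*a*T + 1/8*b*T - 3/8*b - 3/8*T^2 + 3/4*T - 1/8) * h4 + (1/8*p*a
        + 1/4*p*b - 1/2*p*T + 1/4*p - 1/8*a*T + 3/8*a - 1/8*b*T + 3/8*T^2 - 3/4*T + 1/8) * h5 +
        (1/2*O3 + 1/2*OU - 1/2*p*q + 1/2*p*a + 1/2*p*b - 1/4*p*T + 3/4*p + 1/4*q*T - 1/4*q -
        1/2*a^2 + 1/2*a*b - 1/4*a*T + 3/4*a - 3/4*b*T + 5/4*b + 1/2*T^2 - 2*T + 3/2) * h6 +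
        (1/4*O1 - 1/4*O3 + 1/4*a^2 - 1/4*a*T + 1/4*a - 1/4*b^2 + 1/4*b*T - 1/4*b) * h7 +
        (1/8*p*a - 1/8*p*b - 1/8*a + 1/8*b) * h8

theorem alg_p2 (O1 O3 OU p q a b T : ℂ)
    (h0 :  - 2*O3*T + 6*O3 - 4*OU*a + 2*OU*T - 2*OU + 2*p*a*T - 4*p*a - 1*p*T^2 + 3*p*T -
      1*q*T^2 + 5*q*T - 4*q - 4*a^2*b + 4*a^2*T - 4*a^2 + 4*a*b*T - 5*a*T^2 + 5*a*T - 1*b*T^2 -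
      1*b*T + 4*b + 2*T^3 - 4*T^2 = 0)
    (h1 :  - 4*O1*p + 2*O1*T + 2*O3 - 4*OU*a + 2*OU*T + 2*OU - 2*p*q*T + 2*p*q + 2*p*a*T -
      4*p*a + 4*p*b^2 - 4*p*b*T + 1*p*T^2 + 1*p*T + 1*q*T^2 - 1*q*T - 4*a^2*b + 2*a^2*T +
      4*a*b*T + 4*a*b - 3*a*T^2 - 1*a*T - 2*b^2*T + 1*b*T^2 - 3*b*T + 4*b + 2*T^2 - 4*T = 0)
    (h2 : 2*O1 - 4*O3*p + 2*O3*T - 4*OU*b + 2*OU*T + 2*OU - 2*p*q*T + 2*p*q + 4*p*a^2 - 4*p*a*T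
      + 2*p*b*T - 4*p*b + 1*p*T^2 + 1*p*T + 1*q*T^2 - 1*q*T - 2*a^2*T - 4*a*b^2 + 4*a*b*T +
      4*a*b + 1*a*T^2 - 3*a*T + 4*a + 2*b^2*T - 3*b*T^2 - 1*b*T + 2*T^2 - 4*T = 0)
    (h3 :  - 2*O1*T + 6*O1 - 4*OU*b + 2*OU*T - 2*OU + 2*p*b*T - 4*p*b - 1*p*T^2 + 3*p*T -
      1*q*T^2 + 5*q*T - 4*q - 4*a*b^2 + 4*a*b*T - 1*a*T^2 - 1*a*T + 4*a + 4*b^2*T - 4*b^2 -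
      5*b*T^2 + 5*b*T + 2*T^3 - 4*T^2 = 0)
    (h4 : 1*O1 - 4*O3*a + 2*O3*T - 1*O3 - 2*OU*q + 4*OU + 1*p*q*T - 1*p*q - 2*p*T + 2*p -
      2*q*a*b - 1*q*a*T + 4*q*a + 1*q*b*T - 2*q*T + 4*a^3 - 6*a^2*T + 4*a*T^2 - 1*a*T - 4*a +
      1*b*T - 1*T^3 + 1*T^2 + 2*T = 0)
    (h5 :  - 4*O1*b + 2*O1*T - 1*O1 + 1*O3 - 2*OU*q + 4*OU + 1*p*q*T - 1*p*q - 2*p*T + 2*p -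
      2*q*a*b + 1*q*a*T - 1*q*b*T + 4*q*b - 2*q*T + 1*a*T + 4*b^3 - 6*b^2*T + 4*b*T^2 - 1*b*T -
      4*b - 1*T^3 + 1*T^2 + 2*T = 0)
    (h6 :  - 1*O1*T + 1*O1 + 1*O3*T - 1*O3 - 1*a^2*T + 1*a*T^2 + 1*a*T + 1*b^2*T - 1*b*T^2 -
      1*b*T = 0)
    (h7 : 2*O3*T - 2*O3 + 2*OU*T - 2*OU - 1*p*T^2 + 3*p*T + 1*q*T^2 - 3*q*T - 2*a^2*T + 2*a*b*T
      + 1*a*T^2 + 1*a*T - 1*b*T^2 - 1*b*T = 0)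
    (h8 : 1*O1 + 1*O3 - 2*OU*q + 2*OU*T - 2*OU + 1*p*q*T - 1*p*q - 1*p*T^2 + 3*p*T - 2*p -
      2*q*a*b + 1*q*a*T + 1*q*b*T - 1*q*T^2 + 1*q*T + 2*a*b*T - 4*a*b - 1*a*T^2 + 2*a*T -
      1*b*T^2 + 2*b*T + 1*T^3 - 3*T^2 + 2*T = 0) :
    (p - 1) * (b - 1) * (p - q) = 0 := by
  have h9 := alg_p1 O1 O3 OU p q a b T h0 h1 h2 h3 h4 h5 h6 h7 h8
  linear_combination
      ( - 1/8*p*q + 1/8*p*b + 1/8*p + 1/4*a*b - 1/8*a*T + 3/8*a - 1/8*b*T + 1/8*T^2 - 1/8*T) *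
        h0 + ( - 1/8*p*b + 1/8*q - 1/4*a*b + 1/8*a*T - 3/8*a + 1/8*b*T - 1/8*T^2 + 1/8*T - 1/8)
        * h1 + (1/8*p*a - 1/8*q + 1/4*a*b - 1/8*a*T + 1/4*a - 1/8*b*T + 1/8*b + 1/8*T^2 - 1/8*T
        + 1/8) * h2 + (1/8*p*q - 1/8*p*a + 1/4*p*T - 3/8*p - 1/4*a*b + 1/8*a*T - 1/4*a +
        1/8*b*T - 1/8*b - 1/8*T^2 - 1/8*T + 1/4) * h3 + ( - 1/8*p^2 - 1/4*p*b + 1/4*p*T - 1/4*p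
        + 1/4*b - 1/4*T + 3/8) * h4 + (1/8*p^2 + 1/4*p*a - 1/4*a - 1/8) * h5 + (1/4*p^2 -
        1/4*p*q + 1/4*p*a - 3/4*p*b + 7/4*p + 1/4*q - 1/4*a + 3/4*b - 2) * h6 + (1/2*p*b -
        1/2*p - 1/2*b + 1/2) * h7 + ( - 1/4*p*T + 1/4*p + 1/4*T - 1/4) * h8 + ( - 1*O1 - 1*OU -
        1/2*p + 1/2*q + 1*b - 3*T) * h9

theorem alg_goal (O1 O3 OU q a b T : ℂ) (hq : 1 - q ≠ 0) (ha : a - 1 ≠ 0)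
    (h0 :  - 2*O3*T + 6*O3 - 4*OU*a + 2*OU*T - 2*OU - 1*q*T^2 + 5*q*T - 4*q - 4*a^2*b + 4*a^2*T
      - 4*a^2 + 4*a*b*T - 5*a*T^2 + 7*a*T - 4*a - 1*b*T^2 - 1*b*T + 4*b + 2*T^3 - 5*T^2 + 3*T =
      0)
    (h1 : 2*O1*T - 4*O1 + 2*O3 - 4*OU*a + 2*OU*T + 2*OU + 1*q*T^2 - 3*q*T + 2*q - 4*a^2*b +
      2*a^2*T + 4*a*b*T + 4*a*b - 3*a*T^2 + 1*a*T - 4*a - 2*b^2*T + 4*b^2 + 1*b*T^2 - 7*b*T +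
      4*b + 3*T^2 - 3*T = 0)
    (h2 : 2*O1 + 2*O3*T - 4*O3 - 4*OU*b + 2*OU*T + 2*OU + 1*q*T^2 - 3*q*T + 2*q - 2*a^2*T +
      4*a^2 - 4*a*b^2 + 4*a*b*T + 4*a*b + 1*a*T^2 - 7*a*T + 4*a + 2*b^2*T - 3*b*T^2 + 1*b*T -
      4*b + 3*T^2 - 3*T = 0)
    (h3 :  - 2*O1*T + 6*O1 - 4*OU*b + 2*OU*T - 2*OU - 1*q*T^2 + 5*q*T - 4*q - 4*a*b^2 + 4*a*b*T
      - 1*a*T^2 - 1*a*T + 4*a + 4*b^2*T - 4*b^2 - 5*b*T^2 + 7*b*T - 4*b + 2*T^3 - 5*T^2 + 3*T =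
      0)
    (h4 : 1*O1 - 4*O3*a + 2*O3*T - 1*O3 - 2*OU*q + 4*OU - 2*q*a*b - 1*q*a*T + 4*q*a + 1*q*b*T -
      1*q*T - 1*q + 4*a^3 - 6*a^2*T + 4*a*T^2 - 1*a*T - 4*a + 1*b*T - 1*T^3 + 1*T^2 + 2 = 0)
    (h5 :  - 4*O1*b + 2*O1*T - 1*O1 + 1*O3 - 2*OU*q + 4*OU - 2*q*a*b + 1*q*a*T - 1*q*b*T +
      4*q*b - 1*q*T - 1*q + 1*a*T + 4*b^3 - 6*b^2*T + 4*b*T^2 - 1*b*T - 4*b - 1*T^3 + 1*T^2 + 2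
      = 0)
    (h6 :  - 1*O1*T + 1*O1 + 1*O3*T - 1*O3 - 1*a^2*T + 1*a*T^2 + 1*a*T + 1*b^2*T - 1*b*T^2 -
      1*b*T = 0)
    (h7 : 2*O3*T - 2*O3 + 2*OU*T - 2*OU + 1*q*T^2 - 3*q*T - 2*a^2*T + 2*a*b*T + 1*a*T^2 + 1*a*T
      - 1*b*T^2 - 1*b*T - 1*T^2 + 3*T = 0)
    (h8 : 1*O1 + 1*O3 - 2*OU*q + 2*OU*T - 2*OU - 2*q*a*b + 1*q*a*T + 1*q*b*T - 1*q*T^2 + 2*q*T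
      - 1*q + 2*a*b*T - 4*a*b - 1*a*T^2 + 2*a*T - 1*b*T^2 + 2*b*T + 1*T^3 - 4*T^2 + 5*T - 2 =
      0) :
    (a+b-2)^2+((T-1)^2-4*(T-1))*(a+b-2)+4*(T-1)^2-(T-1)^3 = 0 := by
  have k1 : 1*O1 + 1*O3 - 2*OU + 1*q*T - 1*q - 1*T^2 + 3*T - 2 = 0 := by
    refine (mul_eq_zero.mp (?_ : _ * (1 - q) = 0)).resolve_right hq
    linear_combination
      ( - 1/2*q - 1/2*a - 1/2*b + 3/2*T) * h0 + (1/2*a + 1/2*b - 1*T) * h1 + ( - 1/2*q + 1/2*T)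
        * h2 + (1/2*T - 1/2) * h4 + (1/2*T - 1/2) * h5 + (1*a - 1*b - 1*T + 1) * h6 + (1*T - 1)
        * h7 + (1*a + 1*b - 2*T) * h8
  have k2 :  - 1*O1*T + 2*O1 + 1*O3*T - 4*O3 + 4*OU*b - 2*OU*T = 0 := by
    refine (mul_eq_zero.mp (?_ : _ * (1 - q) = 0)).resolve_right hq
    linear_combination
      ( - 1/2*q*a + 1/2*q*b + 1/2*q*T + 1/2*a*b + 1/2*b^2 - 3/2*b*T - 1/2*b + 1*T - 1/2) * h0 +
        (1/2*q*a - 1/2*q*b - 1/2*q*T + 1/2*q - 1/2*a*b - 1/2*b^2 + 1*b*T + 1*b - 1/2*T - 1/2) *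
        h1 + (1/2*q*a + 1/2*q*b - 1/2*q - 1/2*a - 1/2*b*T + 1/2*T) * h2 + (1/2*q*T - 1*q -
        1/2*b*T + 1/2*b + 1/2) * h4 + (1/2*q - 1/2*b*T + 1/2*b + 1/2*T - 1) * h5 + (1*q*a -
        1*q*b - 1*q*T + 2*q - 1*a*b + 1*b^2 + 1*b*T - 1*b - 1) * h6 + ( - 1/2*q*a + 1/2*q*b +
        1/2*q*T - 1/2*q + 1/2*a - 1*b*T + 1/2*b + 1/2*T - 1/2) * h7 + ( - 1/2*q*T + 1/2*q -
        1*a*b + 1*a - 1*b^2 + 2*b*T + 1*b - 3/2*T - 1/2) * h8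
  have k3 : 2*O1*b + 1*O1*T - 6*O1 - 2*O3*b - 1*O3*T + 8*O3 + 2*OU*T - 4*OU + 2*q*b - 2*a*T + 4*b + 2*T^2 - 6*T = 0 := by
    refine (mul_eq_zero.mp (?_ : _ * (1 - q) = 0)).resolve_right hq
    linear_combination
      (1/2*q*a - 1/2*q*b + 1/2*q*T - 1*q - 1*a^2 + 1/2*a*b + 3*a*T - 5/2*a + 1/2*b^2 - 7/2*b*T
        + 1*b + 2*T + 1/2) * h0 + ( - 1/2*q*a + 3/2*q*b - 1/2*q*T - 2*q + 1*a^2 - 5/2*a*b -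
        5/2*a*T + 9/2*a - 5/2*b^2 + 11/2*b*T - 5/2*b - 1/2*T^2 - 3/2*T + 5/2) * h1 + ( -
        1/2*q*a - 1/2*q*b + 1*q*T + 2*a^2 + 2*a*b - 7/2*a*T + 5/2*a - 2*b + 1/2*T^2 + 3/2*T -
        3) * h2 + ( - 1/2*q*T + 1*q + 3/2*a*T - 3*a - 5/2*b - 7/2*T^2 + 14*T - 7) * h4 + (1*q*T
        - 3/2*q - 3/2*a*T + 4*a - 1*b*T + 5/2*b + 7/2*T^2 - 23/2*T + 9/2) * h5 + (2*O3 + 2*OU -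
        1*q*a - 1*q*b + 2*q*T - 5*q + 3*a*b - 7*a*T + 17*a - 1*b^2 - 6*b*T + 18*b + 6*T^2 -
        25*T + 24) * h6 + (1*O1 - 1*O3 + 1/2*q*a + 1/2*q*b - 1/2*q*T + 1/2*q - 2*a*b + 1*a*T +
        5/2*a - 1/2*b - 1/2*T - 3/2) * h7 + ( - 1/2*q*T + 1/2*q - 1*a*b + 3*a + 1*b^2 + 1*b -
        3/2*T - 5/2) * h8
  have k4 : 1*O1*T - 4*O1 - 1*O3*T + 2*O3 + 4*OU*a - 2*OU*T = 0 := by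
    refine (mul_eq_zero.mp (?_ : _ * (1 - q) = 0)).resolve_right hq
    linear_combination
      (1/2*q*a - 1/2*q*b + 1/2*q*T + 1/2*a*b - 1*a + 1/2*b^2 - 3/2*b*T + 1/2*b + 1*T - 1/2) *
        h0 + ( - 1/2*q*a + 3/2*q*b - 1/2*q*T - 1/2*q - 1/2*a*b + 1*a - 1/2*b^2 + 1*b*T - 1*b -
        1/2*T + 1/2) * h1 + ( - 1/2*q*a + 1/2*q*b + 1/2*q + 1/2*a - 1/2*b*T + 1/2*T - 1) * h2 +
        ( - 1/2*q*T + 1*q - 1/2*b*T + 1/2*b + 1*T - 3/2) * h4 + (1*q*T - 3/2*q - 1/2*b*T +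
        1/2*b - 1/2*T + 1) * h5 + ( - 1*q*a - 1*q*b + 1*q*T - 2*q - 1*a*b + 2*a + 1*b^2 + 1*b*T
        - 1*b - 2*T + 3) * h6 + (1/2*q*a - 1/2*q*b + 1/2*q*T - 1/2*q - 1/2*a - 1*b*T + 3/2*b +
        1/2*T - 1/2) * h7 + ( - 1/2*q*T + 1/2*q - 1*a*b + 1*a - 1*b^2 + 2*b*T + 1*b - 3/2*T -
        1/2) * h8
  have k5 : 2*O1*a + 1*O1*T - 8*O1 - 2*O3*a - 1*O3*T + 6*O3 - 2*OU*T + 4*OU - 2*q*a - 4*a + 2*b*T - 2*T^2 + 6*T = 0 := by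
    refine (mul_eq_zero.mp (?_ : _ * (1 - q) = 0)).resolve_right hq
    linear_combination
      (1/2*q*a - 1/2*q*b - 1/2*q*T + 1*q + 1*a^2 - 1/2*a*b - 3*a*T + 3/2*a - 1/2*b^2 + 7/2*b*T
        - 2*T - 1/2) * h0 + ( - 1/2*q*a + 3/2*q*b - 1/2*q*T - 1*a^2 + 5/2*a*b + 5/2*a*T - 7/2*a
        + 5/2*b^2 - 11/2*b*T - 1/2*b + 1/2*T^2 + 5/2*T - 1/2) * h1 + ( - 3/2*q*a + 1/2*q*b +
        2*q - 2*a^2 - 2*a*b + 7/2*a*T - 1/2*a + 2*b - 1/2*T^2 - 5/2*T + 1) * h2 + ( - 3/2*q*T +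
        2*q - 3/2*a*T + 3*a + 5/2*b + 7/2*T^2 - 12*T + 4) * h4 + (1*q*T - 3/2*q + 3/2*a*T - 4*a
        + 1*b*T - 5/2*b - 7/2*T^2 + 19/2*T - 3/2) * h5 + ( - 2*O3 - 2*OU - 1*q*a - 1*q*b + 1*q
        - 3*a*b + 7*a*T - 15*a + 1*b^2 + 6*b*T - 16*b - 6*T^2 + 23*T - 20) * h6 + ( - 1*O1 +
        1*O3 - 1/2*q*a - 1/2*q*b + 1/2*q*T - 1/2*q + 2*a*b - 1*a*T - 5/2*a + 1/2*b + 1/2*T +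
        3/2) * h7 + (1/2*q*T - 1/2*q + 1*a*b - 3*a - 1*b^2 - 1*b + 3/2*T + 5/2) * h8
  refine (mul_eq_zero.mp (?_ : _ * (a - 1) = 0)).resolve_right ha
  linear_combination
      (1*a + 3/4*b - 5/4*T - 3/2) * h0 + ( - 1/2*a + 3/4*b - 1/2*T - 7/4) * h1 + ( - 3/2*a +
        1*T + 1/2) * h2 + (1/2*b - 3/2*T + 11/4) * h4 + ( - 1/2*T - 3/4) * h5 + (7/2*b - 5/2*T
        + 7/2) * h6 + (1/2*b - 5/4*T + 5/4) * h7 + ( - 1/2*b + 2*T - 2) * h8 + (1*a*b - 2*b*T +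
        3/2*T^2 - 4*T + 7/2) * k1 + ( - 3/2*a + 1/4*T) * k2 + ( - 1/2*a + 9/4) * k3 + (1/2*a +
        2*b - 3/2*T - 9/4) * k4 + ( - 1/4*T + 3/2) * k5



/-- The triple product of `X₁`, `X₂ + X₄`, `X₃` vanishes. -/
theorem kappa_zero (h : ℂ) (X1 X2 X3 X4 : V3)
    (n2 : dot X2 X2 = 1 - h ^ 2) (n4 : dot X4 X4 = 1 - h ^ 2)
    (hA : dot X1 X4 = dot X1 X2) (hB : dot X3 X4 = dot X2 X3)
    (s : rs h X2 X3 X1 = rs h X4 X1 X3) (eu : ru h X2 X3 X1 = ru h X4 X1 X3)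
    (ev : rv h X2 X3 X1 = rv h X4 X1 X3) (ew : rww h X2 X3 X1 = rww h X4 X1 X3) :
    tri X3 X4 X1 = tri X1 X2 X3 := by
  by_contra hne
  have hk : tri X1 X2 X3 - tri X3 X4 X1 ≠ 0 := fun hh => hne (by linear_combination -hh)
  have du : X4.u = X2.u := by
    apply mul_left_cancel₀ hk
    simp only [dot, tri, cu, cv, cw] at *
    linear_combination (((X2.v + X4.v) * X3.w - X3.v * (X2.w + X4.w)) / 2) * hA
      + ((X3.v * X1.w - X1.v * X3.w) / 2) * (n4 - n2)
      + ((X1.v * (X2.w + X4.w) - (X2.v + X4.v) * X1.w) / 2) * hB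
  have dv : X4.v = X2.v := by
    apply mul_left_cancel₀ hk
    simp only [dot, tri, cu, cv, cw] at *
    linear_combination ((X2.u + X4.u) * X3.v - (X2.v + X4.v) * X3.u) * hA
      + (X3.u * X1.v - X3.v * X1.u) * (n4 - n2)
      + (X1.u * (X2.v + X4.v) - X1.v * (X2.u + X4.u)) * hB
  have dw : X4.w = X2.w := by
    apply mul_left_cancel₀ hk
    simp only [dot, tri, cu, cv, cw] at *
    linear_combination ((X2.w + X4.w) * X3.u - (X2.u + X4.u) * X3.w) * hA
      + (X3.w * X1.u - X3.u * X1.w) * (n4 - n2)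
      + (X1.w * (X2.u + X4.u) - X1.u * (X2.w + X4.w)) * hB
  have h42 : X4 = X2 := by
    cases X4; cases X2; simp_all
  subst h42
  have ht : tri X3 X4 X1 = -tri X1 X4 X3 := by
    simp only [tri, cu, cv, cw]; ring
  have hm : tri X1 X4 X3 ≠ 0 := by
    intro h0; rw [ht, h0] at hne; simp at hne
  have f1 : tri X1 X4 X3 * (1 - 4 * h ^ 2) = 0 := by
    simp only [rs, cc, dot, tri, cu, cv, cw] at *
    linear_combination (1 / 2) * s
  have f2 : tri X1 X4 X3 * (h * (1 - 4 * dot X4 X4)) = 0 := by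
    simp only [ru, rv, rww, cc, dot, tri, cu, cv, cw] at *
    linear_combination (1 / 2) * (-X4.u * eu - (X4.w * ev + X4.v * ew) / 2)
  have g1 := (mul_eq_zero.mp f1).resolve_left hm
  have g2 := (mul_eq_zero.mp f2).resolve_left hm
  rw [n2] at g2
  have h0 : h = 0 := by linear_combination (-1 / 2) * g2 + (h / 2) * (-g1)
  rw [h0] at g1
  norm_num at g1

/-- Pairing a vector equation with `Y`. -/
theorem pair_eq (k1 k2 k3 k4 m : ℂ) (X1 X2 X3 X4 Y : V3) (cU cV cW : ℂ)
    (eu : k1 * X1.u + k2 * X2.u + k3 * X3.u + k4 * X4.u + m * cU = 0)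
    (ev : k1 * X1.v + k2 * X2.v + k3 * X3.v + k4 * X4.v + m * cV = 0)
    (ew : k1 * X1.w + k2 * X2.w + k3 * X3.w + k4 * X4.w + m * cW = 0) :
    k1 * dot X1 Y + k2 * dot X2 Y + k3 * dot X3 Y + k4 * dot X4 Y
      + m * (-(Y.u * cU) - (Y.v * cW + Y.w * cV) / 2) = 0 := by
  simp only [dot]
  linear_combination -Y.u * eu - (Y.w * ev + Y.v * ew) / 2

theorem dot_symm (X Y : V3) : dot X Y = dot Y X := by
  simp only [dot]; ring

theorem core (h : ℂ) (X1 X2 X3 X4 : V3)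
    (n1 : dot X1 X1 = 1 - h ^ 2) (n2 : dot X2 X2 = 1 - h ^ 2)
    (n3 : dot X3 X3 = 1 - h ^ 2) (n4 : dot X4 X4 = 1 - h ^ 2)
    (hA : dot X1 X4 = dot X1 X2) (hB : dot X3 X4 = dot X2 X3)
    (s12 : rs h X1 X2 X4 = rs h X2 X3 X1) (s23 : rs h X2 X3 X1 = rs h X3 X4 X2)
    (s34 : rs h X3 X4 X2 = rs h X4 X1 X3)
    (u12 : ru h X1 X2 X4 = ru h X2 X3 X1) (u23 : ru h X2 X3 X1 = ru h X3 X4 X2)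
    (u34 : ru h X3 X4 X2 = ru h X4 X1 X3)
    (v12 : rv h X1 X2 X4 = rv h X2 X3 X1) (v23 : rv h X2 X3 X1 = rv h X3 X4 X2)
    (v34 : rv h X3 X4 X2 = rv h X4 X1 X3)
    (w12 : rww h X1 X2 X4 = rww h X2 X3 X1) (w23 : rww h X2 X3 X1 = rww h X3 X4 X2)
    (w34 : rww h X3 X4 X2 = rww h X4 X1 X3)
    (T a b p q : ℂ) (hT : T = 4 * h ^ 2)
    (ha : a = 2 * h ^ 2 - 2 * dot X1 X2) (hb : b = 2 * h ^ 2 - 2 * dot X2 X3)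
    (hp : p = 2 * h ^ 2 - 2 * dot X1 X3) (hq : q = 2 * h ^ 2 - 2 * dot X2 X4)
    (ha1 : a ≠ 1) (hb1 : b ≠ 1) (hpq : p ≠ q) :
    (a+b-2)^2+((T-1)^2-4*(T-1))*(a+b-2)+4*(T-1)^2-(T-1)^3 = 0 := by
  have hk := kappa_zero h X1 X2 X3 X4 n2 n4 hA hB (s23.trans s34) (u23.trans u34)
    (v23.trans v34) (w23.trans w34)
  -- the common triple products
  obtain ⟨o1, ho1⟩ : ∃ o, o = 2 * tri X3 X2 X4 := ⟨_, rfl⟩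
  obtain ⟨o3, ho3⟩ : ∃ o, o = -2 * tri X1 X2 X4 := ⟨_, rfl⟩
  obtain ⟨oU, hoU⟩ : ∃ o, o = 2 * tri X1 X2 X3 := ⟨_, rfl⟩
  have d21 := dot_symm X2 X1
  have d31 := dot_symm X3 X1
  have d41 := dot_symm X4 X1
  have d32 := dot_symm X3 X2
  have d42 := dot_symm X4 X2
  have d43 := dot_symm X4 X3
  obtain ⟨A, dA⟩ : ∃ o, o = dot X1 X2 := ⟨_, rfl⟩
  obtain ⟨B, dB⟩ : ∃ o, o = dot X2 X3 := ⟨_, rfl⟩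
  obtain ⟨P, dP⟩ : ∃ o, o = dot X1 X3 := ⟨_, rfl⟩
  obtain ⟨Q, dQ⟩ : ∃ o, o = dot X2 X4 := ⟨_, rfl⟩
  have t1 : tri X1 X2 X4 = -o3 / 2 := by rw [ho3]; ring
  have t1' : tri X4 X1 X2 = -o3 / 2 := by rw [ho3]; simp only [tri, cu, cv, cw]; ring
  have t3 : tri X3 X4 X2 = -o1 / 2 := by rw [ho1]; simp only [tri, cu, cv, cw]; ring
  have t3' : tri X2 X3 X4 = -o1 / 2 := by rw [ho1]; simp only [tri, cu, cv, cw]; ring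
  have t2 : tri X2 X3 X1 = oU / 2 := by rw [hoU]; simp only [tri, cu, cv, cw]; ring
  have t2' : tri X1 X2 X3 = oU / 2 := by rw [hoU]; ring
  have t4 : tri X4 X1 X3 = oU / 2 := by
    rw [hoU]
    have : tri X4 X1 X3 = tri X3 X4 X1 := by simp only [tri, cu, cv, cw]; ring
    rw [this, hk]; ring
  have t4' : tri X3 X4 X1 = oU / 2 := by rw [hk, t2']
  have c1 : cc h X1 X2 X4 = 2 * (h ^ 2 - (Q * (2 * h ^ 2 - 1) - h * o3 + 2 * A * A)) := by
    rw [cc, t1, hA, ← dA, ← dQ]; ring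
  have c2 : cc h X2 X3 X1 = 2 * (h ^ 2 - (P * (2 * h ^ 2 - 1) + h * oU + 2 * A * B)) := by
    rw [cc, t2, d21, d31, ← dA, ← dP, ← dB]; ring
  have c3 : cc h X3 X4 X2 = 2 * (h ^ 2 - (Q * (2 * h ^ 2 - 1) - h * o1 + 2 * B * B)) := by
    rw [cc, t3, d32, hB, d42, ← dB, ← dQ]; ring
  have c4 : cc h X4 X1 X3 = 2 * (h ^ 2 - (P * (2 * h ^ 2 - 1) + h * oU + 2 * A * B)) := by
    rw [cc, t4, d41, d43, hA, hB, ← dA, ← dP, ← dB]; ring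
  obtain ⟨e1, he1⟩ : ∃ o, o = 2 * (h ^ 2 - (Q * (2 * h ^ 2 - 1) - h * o3 + 2 * A * A))
    - h ^ 2 - Q := ⟨_, rfl⟩
  obtain ⟨e3, he3⟩ : ∃ o, o = 2 * (h ^ 2 - (Q * (2 * h ^ 2 - 1) - h * o1 + 2 * B * B))
    - h ^ 2 - Q := ⟨_, rfl⟩
  obtain ⟨e, he⟩ : ∃ o, o = 2 * (h ^ 2 - (P * (2 * h ^ 2 - 1) + h * oU + 2 * A * B))
    - h ^ 2 - P := ⟨_, rfl⟩
  rw [show (2 * (h ^ 2 - (Q * (2 * h ^ 2 - 1) - h * o3 + 2 * A * A)) : ℂ) = e1 + h ^ 2 + Q by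
    rw [he1]; ring] at c1
  rw [show (2 * (h ^ 2 - (Q * (2 * h ^ 2 - 1) - h * o1 + 2 * B * B)) : ℂ) = e3 + h ^ 2 + Q by
    rw [he3]; ring] at c3
  rw [show (2 * (h ^ 2 - (P * (2 * h ^ 2 - 1) + h * oU + 2 * A * B)) : ℂ) = e + h ^ 2 + P by
    rw [he]; ring] at c2 c4
  simp only [rs, ru, rv, rww, c1, c2, c3, c4, t1', t2', t3', t4', d21, d31, d41, d32, d42, d43,
    hA, hB, ← dA, ← dB, ← dP, ← dQ] at s12 s23 s34 u12 u23 u34 v12 v23 v34 w12 w23 w34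
  rw [← dA] at ha hA
  rw [← dB] at hb hB
  rw [← dP] at hp
  rw [← dQ] at hq
  -- vector equations
  have Vpair := fun Y => pair_eq (e1 - h ^ 2 - B) (h ^ 2 + A - e / 2) (-(h ^ 2 + A))
    (h ^ 2 + A - e / 2) (h / 2) X1 X2 X3 X4 Y
    (cu X4 X1 - cu X2 X1 + cu X4 X3 - cu X2 X3 + 2 * cu X2 X4)
    (cv X4 X1 - cv X2 X1 + cv X4 X3 - cv X2 X3 + 2 * cv X2 X4)
    (cw X4 X1 - cw X2 X1 + cw X4 X3 - cw X2 X3 + 2 * cw X2 X4)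
    (by simp only [cu] at *; linear_combination u12 + (1 / 2) * (u23 + u34))
    (by simp only [cv] at *; linear_combination v12 + (1 / 2) * (v23 + v34))
    (by simp only [cw] at *; linear_combination w12 + (1 / 2) * (w23 + w34))
  have V2pair := fun Y => pair_eq (-(h ^ 2 + B)) (h ^ 2 + B - e / 2) (e3 - h ^ 2 - A)
    (h ^ 2 + B - e / 2) (-(h / 2)) X1 X2 X3 X4 Y
    (cu X4 X1 - cu X2 X1 + cu X4 X3 - cu X2 X3 + 2 * cu X2 X4)
    (cv X4 X1 - cv X2 X1 + cv X4 X3 - cv X2 X3 + 2 * cv X2 X4)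
    (cw X4 X1 - cw X2 X1 + cw X4 X3 - cw X2 X3 + 2 * cw X2 X4)
    (by simp only [cu] at *; linear_combination (1 / 2) * (u34 - u23))
    (by simp only [cv] at *; linear_combination (1 / 2) * (v34 - v23))
    (by simp only [cw] at *; linear_combination (1 / 2) * (w34 - w23))
  have Dpair := fun Y => pair_eq 0 (-e) 0 e h X1 X2 X3 X4 Y
    (cu X3 X2 + cu X3 X4 - cu X1 X2 - cu X1 X4 + 2 * cu X1 X3)
    (cv X3 X2 + cv X3 X4 - cv X1 X2 - cv X1 X4 + 2 * cv X1 X3)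
    (cw X3 X2 + cw X3 X4 - cw X1 X2 - cw X1 X4 + 2 * cw X1 X3)
    (by simp only [cu] at *; linear_combination -(u23 + u34))
    (by simp only [cv] at *; linear_combination -(v23 + v34))
    (by simp only [cw] at *; linear_combination -(w23 + w34))
  have k1 :
      -(X1.u * (cu X4 X1 - cu X2 X1 + cu X4 X3 - cu X2 X3 + 2 * cu X2 X4))
      - (X1.v * (cw X4 X1 - cw X2 X1 + cw X4 X3 - cw X2 X3 + 2 * cw X2 X4)
        + X1.w * (cv X4 X1 - cv X2 X1 + cv X4 X3 - cv X2 X3 + 2 * cv X2 X4)) / 2 = -(oU + o3) := by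
    simp only [tri, cu, cv, cw] at t1 t1' t2 t2' t3 t3' t4 t4' ⊢
    linear_combination -t4 - t2' + 2 * t1
  have k3 :
      -(X3.u * (cu X4 X1 - cu X2 X1 + cu X4 X3 - cu X2 X3 + 2 * cu X2 X4))
      - (X3.v * (cw X4 X1 - cw X2 X1 + cw X4 X3 - cw X2 X3 + 2 * cw X2 X4)
        + X3.w * (cv X4 X1 - cv X2 X1 + cv X4 X3 - cv X2 X3 + 2 * cv X2 X4)) / 2 = oU + o1 := by
    simp only [tri, cu, cv, cw] at t1 t1' t2 t2' t3 t3' t4 t4' ⊢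
    linear_combination t4' + t2' - 2 * t3
  have k2 :
      -(X2.u * (cu X4 X1 - cu X2 X1 + cu X4 X3 - cu X2 X3 + 2 * cu X2 X4))
      - (X2.v * (cw X4 X1 - cw X2 X1 + cw X4 X3 - cw X2 X3 + 2 * cw X2 X4)
        + X2.w * (cv X4 X1 - cv X2 X1 + cv X4 X3 - cv X2 X3 + 2 * cv X2 X4)) / 2 = (o1 - o3) / 2 := by
    simp only [tri, cu, cv, cw] at t1 t1' t2 t2' t3 t3' t4 t4' ⊢
    linear_combination t1' - t3'
  have k4 :
      -(X4.u * (cu X4 X1 - cu X2 X1 + cu X4 X3 - cu X2 X3 + 2 * cu X2 X4))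
      - (X4.v * (cw X4 X1 - cw X2 X1 + cw X4 X3 - cw X2 X3 + 2 * cw X2 X4)
        + X4.w * (cv X4 X1 - cv X2 X1 + cv X4 X3 - cv X2 X3 + 2 * cv X2 X4)) / 2 = (o1 - o3) / 2 := by
    simp only [tri, cu, cv, cw] at t1 t1' t2 t2' t3 t3' t4 t4' ⊢
    linear_combination t1' - t3'
  have m2 :
      -(X2.u * (cu X3 X2 + cu X3 X4 - cu X1 X2 - cu X1 X4 + 2 * cu X1 X3))
      - (X2.v * (cw X3 X2 + cw X3 X4 - cw X1 X2 - cw X1 X4 + 2 * cw X1 X3)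
        + X2.w * (cv X3 X2 + cv X3 X4 - cv X1 X2 - cv X1 X4 + 2 * cv X1 X3)) / 2 = -(o1 / 2) - o3 / 2 - oU := by
    simp only [tri, cu, cv, cw] at t1 t1' t2 t2' t3 t3' t4 t4' ⊢
    linear_combination t3' + t1' - 2 * t2'
  have m4 :
      -(X4.u * (cu X3 X2 + cu X3 X4 - cu X1 X2 - cu X1 X4 + 2 * cu X1 X3))
      - (X4.v * (cw X3 X2 + cw X3 X4 - cw X1 X2 - cw X1 X4 + 2 * cw X1 X3)
        + X4.w * (cv X3 X2 + cv X3 X4 - cv X1 X2 - cv X1 X4 + 2 * cv X1 X3)) / 2 = o1 / 2 + o3 / 2 + oU := by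
    simp only [tri, cu, cv, cw] at t1 t1' t2 t2' t3 t3' t4 t4' ⊢
    linear_combination -t3' - t1' + 2 * t4
  have VX1 := Vpair X1
  rw [k1] at VX1
  simp only [n1, n2, n3, n4, d21, d31, d41, d32, d42, d43, hA, hB, ← dA, ← dB, ← dP, ← dQ] at VX1
  have VX2 := Vpair X2
  rw [k2] at VX2
  simp only [n1, n2, n3, n4, d21, d31, d41, d32, d42, d43, hA, hB, ← dA, ← dB, ← dP, ← dQ] at VX2
  have VX3 := Vpair X3
  rw [k3] at VX3
  simp only [n1, n2, n3, n4, d21, d31, d41, d32, d42, d43, hA, hB, ← dA, ← dB, ← dP, ← dQ] at VX3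
  have VX4 := Vpair X4
  rw [k4] at VX4
  simp only [n1, n2, n3, n4, d21, d31, d41, d32, d42, d43, hA, hB, ← dA, ← dB, ← dP, ← dQ] at VX4
  have V2X1 := V2pair X1
  rw [k1] at V2X1
  simp only [n1, n2, n3, n4, d21, d31, d41, d32, d42, d43, hA, hB, ← dA, ← dB, ← dP, ← dQ] at V2X1
  have V2X2 := V2pair X2
  rw [k2] at V2X2
  simp only [n1, n2, n3, n4, d21, d31, d41, d32, d42, d43, hA, hB, ← dA, ← dB, ← dP, ← dQ] at V2X2
  have V2X3 := V2pair X3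
  rw [k3] at V2X3
  simp only [n1, n2, n3, n4, d21, d31, d41, d32, d42, d43, hA, hB, ← dA, ← dB, ← dP, ← dQ] at V2X3
  have V2X4 := V2pair X4
  rw [k4] at V2X4
  simp only [n1, n2, n3, n4, d21, d31, d41, d32, d42, d43, hA, hB, ← dA, ← dB, ← dP, ← dQ] at V2X4
  have DX2 := Dpair X2
  rw [m2] at DX2
  simp only [n1, n2, n3, n4, d21, d31, d41, d32, d42, d43, hA, hB, ← dA, ← dB, ← dP, ← dQ] at DX2
  have DX4 := Dpair X4
  rw [m4] at DX4
  simp only [n1, n2, n3, n4, d21, d31, d41, d32, d42, d43, hA, hB, ← dA, ← dB, ← dP, ← dQ] at DX4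
  clear Vpair V2pair Dpair k1 k2 k3 k4 m2 m4 u12 u23 u34 v12 v23 v34 w12 w23 w34
  clear t1 t1' t2 t2' t3 t3' t4 t4' ho1 ho3 hoU c1 c2 c3 c4 hk
  clear n1 n2 n3 n4 d21 d31 d41 d32 d42 d43 hA hB dA dB dP dQ
  have h0 : - 2*(2 * h * o3)*T + 6*(2 * h * o3) - 4*(2 * h * oU)*a + 2*(2 * h * oU)*T - 2*(2 * h *
      oU) + 2*p*a*T - 4*p*a - 1*p*T^2 + 3*p*T - 1*q*T^2 + 5*q*T - 4*q - 4*a^2*b + 4*a^2*T -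
      4*a^2 + 4*a*b*T - 5*a*T^2 + 5*a*T - 1*b*T^2 - 1*b*T + 4*b + 2*T^3 - 4*T^2 = 0 := by
    subst hT ha hb hp hq he1 he3 he
    linear_combination 8*VX1
  have h1 : - 4*(2 * h * o1)*p + 2*(2 * h * o1)*T + 2*(2 * h * o3) - 4*(2 * h * oU)*a + 2*(2 * h *
      oU)*T + 2*(2 * h * oU) - 2*p*q*T + 2*p*q + 2*p*a*T - 4*p*a + 4*p*b^2 - 4*p*b*T + 1*p*T^2
      + 1*p*T + 1*q*T^2 - 1*q*T - 4*a^2*b + 2*a^2*T + 4*a*b*T + 4*a*b - 3*a*T^2 - 1*a*T -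
      2*b^2*T + 1*b*T^2 - 3*b*T + 4*b + 2*T^2 - 4*T = 0 := by
    subst hT ha hb hp hq he1 he3 he
    linear_combination 8*V2X1
  have h2 : 2*(2 * h * o1) - 4*(2 * h * o3)*p + 2*(2 * h * o3)*T - 4*(2 * h * oU)*b + 2*(2 * h *
      oU)*T + 2*(2 * h * oU) - 2*p*q*T + 2*p*q + 4*p*a^2 - 4*p*a*T + 2*p*b*T - 4*p*b + 1*p*T^2
      + 1*p*T + 1*q*T^2 - 1*q*T - 2*a^2*T - 4*a*b^2 + 4*a*b*T + 4*a*b + 1*a*T^2 - 3*a*T + 4*a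
      + 2*b^2*T - 3*b*T^2 - 1*b*T + 2*T^2 - 4*T = 0 := by
    subst hT ha hb hp hq he1 he3 he
    linear_combination 8*VX3
  have h3 : - 2*(2 * h * o1)*T + 6*(2 * h * o1) - 4*(2 * h * oU)*b + 2*(2 * h * oU)*T - 2*(2 * h *
      oU) + 2*p*b*T - 4*p*b - 1*p*T^2 + 3*p*T - 1*q*T^2 + 5*q*T - 4*q - 4*a*b^2 + 4*a*b*T -
      1*a*T^2 - 1*a*T + 4*a + 4*b^2*T - 4*b^2 - 5*b*T^2 + 5*b*T + 2*T^3 - 4*T^2 = 0 := by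
    subst hT ha hb hp hq he1 he3 he
    linear_combination 8*V2X3
  have h4 : 1*(2 * h * o1) - 4*(2 * h * o3)*a + 2*(2 * h * o3)*T - 1*(2 * h * o3) - 2*(2 * h * oU)*q
      + 4*(2 * h * oU) + 1*p*q*T - 1*p*q - 2*p*T + 2*p - 2*q*a*b - 1*q*a*T + 4*q*a + 1*q*b*T -
      2*q*T + 4*a^3 - 6*a^2*T + 4*a*T^2 - 1*a*T - 4*a + 1*b*T - 1*T^3 + 1*T^2 + 2*T = 0 := by
    subst hT ha hb hp hq he1 he3 he
    linear_combination 4*(VX2+VX4)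
  have h5 : - 4*(2 * h * o1)*b + 2*(2 * h * o1)*T - 1*(2 * h * o1) + 1*(2 * h * o3) - 2*(2 * h *
      oU)*q + 4*(2 * h * oU) + 1*p*q*T - 1*p*q - 2*p*T + 2*p - 2*q*a*b + 1*q*a*T - 1*q*b*T +
      4*q*b - 2*q*T + 1*a*T + 4*b^3 - 6*b^2*T + 4*b*T^2 - 1*b*T - 4*b - 1*T^3 + 1*T^2 + 2*T = 0 := by
    subst hT ha hb hp hq he1 he3 he
    linear_combination 4*(V2X2+V2X4)
  have h6 : - 1*(2 * h * o1)*T + 1*(2 * h * o1) + 1*(2 * h * o3)*T - 1*(2 * h * o3) - 1*a^2*T +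
      1*a*T^2 + 1*a*T + 1*b^2*T - 1*b*T^2 - 1*b*T = 0 := by
    subst hT ha hb hp hq he1 he3 he
    linear_combination 4*h*(s12+s23)
  have h7 : 2*(2 * h * o3)*T - 2*(2 * h * o3) + 2*(2 * h * oU)*T - 2*(2 * h * oU) - 1*p*T^2 + 3*p*T
      + 1*q*T^2 - 3*q*T - 2*a^2*T + 2*a*b*T + 1*a*T^2 + 1*a*T - 1*b*T^2 - 1*b*T = 0 := by
    subst hT ha hb hp hq he1 he3 he
    linear_combination 8*h*s12
  have h8 : 1*(2 * h * o1) + 1*(2 * h * o3) - 2*(2 * h * oU)*q + 2*(2 * h * oU)*T - 2*(2 * h * oU) +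
      1*p*q*T - 1*p*q - 1*p*T^2 + 3*p*T - 2*p - 2*q*a*b + 1*q*a*T + 1*q*b*T - 1*q*T^2 + 1*q*T
      + 2*a*b*T - 4*a*b - 1*a*T^2 + 2*a*T - 1*b*T^2 + 2*b*T + 1*T^3 - 3*T^2 + 2*T = 0 := by
    subst hT ha hb hp hq he1 he3 he
    linear_combination 2*(DX4-DX2)
  have hz := alg_p2 (2 * h * o1) (2 * h * o3) (2 * h * oU) p q a b T h0 h1 h2 h3 h4 h5 h6 h7 h8
  have hp1 : p = 1 := by
    rcases mul_eq_zero.mp hz with hz | hz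
    · rcases mul_eq_zero.mp hz with hz | hz
      · exact sub_eq_zero.mp hz
      · exact absurd (sub_eq_zero.mp hz) hb1
    · exact absurd (sub_eq_zero.mp hz) hpq
  rw [hp1] at h0 h1 h2 h3 h4 h5 h7 h8 hpq
  exact alg_goal (2 * h * o1) (2 * h * o3) (2 * h * oU) q a b T (sub_ne_zero.mpr hpq)
    (sub_ne_zero.mpr ha1)
    (by linear_combination h0)
    (by linear_combination h1)
    (by linear_combination h2)
    (by linear_combination h3)
    (by linear_combination h4)
    (by linear_combination h5)
    (by linear_combination h6)
    (by linear_combination h7)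
    (by linear_combination h8)

theorem mat_of (t : ℂ) (x : SL2) (hx : ((x : 𝕄)).trace = t) :
    ∃ X : V3, (x : 𝕄) = mat (t / 2) X ∧ dot X X = 1 - (t / 2) ^ 2 := by
  refine ⟨⟨((x : 𝕄) 0 0 - (x : 𝕄) 1 1) / 2, (x : 𝕄) 0 1, (x : 𝕄) 1 0⟩, ?_, ?_⟩
  · rw [Matrix.trace_fin_two] at hx
    ext i j
    fin_cases i <;> fin_cases j <;> simp [mat]
    · linear_combination (1 / 2) * hx
    · linear_combination (1 / 2) * hx
  · have hd := x.det_coe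
    rw [Matrix.det_fin_two] at hd
    rw [Matrix.trace_fin_two] at hx
    subst hx
    simp only [dot]
    linear_combination hd

theorem trace_mat (h : ℂ) (X Y : V3) : (mat h X * mat h Y).trace = 2 * h ^ 2 - 2 * dot X Y := by
  simp only [mat, Matrix.trace_fin_two, Matrix.mul_apply, Fin.sum_univ_two, dot, Matrix.of_apply,
    Matrix.cons_val', Matrix.cons_val_zero, Matrix.cons_val_one, Matrix.cons_val_fin_one]
  ring

theorem r_eq (h : ℂ) (X Y Z X' Y' Z' : V3) (x y z x' y' z' : SL2)
    (hx : (x : 𝕄) = mat h X) (hy : (y : 𝕄) = mat h Y) (hz : (z : 𝕄) = mat h Z)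
    (hx' : (x' : 𝕄) = mat h X') (hy' : (y' : 𝕄) = mat h Y') (hz' : (z' : 𝕄) = mat h Z')
    (hr : x * y * x⁻¹ * z * x = x' * y' * x'⁻¹ * z' * x') :
    rs h X Y Z = rs h X' Y' Z' ∧ ru h X Y Z = ru h X' Y' Z' ∧ rv h X Y Z = rv h X' Y' Z' ∧
      rww h X Y Z = rww h X' Y' Z' := by
  have hd : (mat h X).det = 1 := by rw [← hx]; exact x.det_coe
  have hd' : (mat h X').det = 1 := by rw [← hx']; exact x'.det_coe
  have hm := congrArg (fun g : SL2 => (g : 𝕄)) hr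
  simp only [Matrix.SpecialLinearGroup.coe_mul, Matrix.SpecialLinearGroup.coe_inv,
    hx, hy, hz, hx', hy', hz'] at hm
  rw [rform h X Y Z hd, rform h X' Y' Z' hd'] at hm
  have e00 := congrFun (congrFun hm 0) 0
  have e01 := congrFun (congrFun hm 0) 1
  have e10 := congrFun (congrFun hm 1) 0
  have e11 := congrFun (congrFun hm 1) 1
  simp only [Matrix.of_apply, Matrix.cons_val', Matrix.cons_val_zero, Matrix.cons_val_one,
    Matrix.cons_val_fin_one] at e00 e01 e10 e11
  refine ⟨?_, ?_, e01, e10⟩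
  · linear_combination (1 / 2) * (e00 + e11)
  · linear_combination (1 / 2) * (e00 - e11)

/-- In the situation of STATEMENT 13, setting `α = t² − 1` and
`μ = tr(x₁x₂) + tr(x₂x₃) − 2`, one has `μ² + (α² − 4α)μ + 4α² − α³ = 0`. -/
theorem stmt14 (t : ℂ) (x₁ x₂ x₃ x₄ : SL2)
    (hx₁ : ((x₁ : 𝕄)).trace = t) (hx₂ : ((x₂ : 𝕄)).trace = t)
    (hx₃ : ((x₃ : 𝕄)).trace = t) (hx₄ : ((x₄ : 𝕄)).trace = t)
    (hr₁₂ : x₁ * x₂ * x₁⁻¹ * x₄ * x₁ = x₂ * x₃ * x₂⁻¹ * x₁ * x₂)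
    (hr₂₃ : x₂ * x₃ * x₂⁻¹ * x₁ * x₂ = x₃ * x₄ * x₃⁻¹ * x₂ * x₃)
    (hr₃₄ : x₃ * x₄ * x₃⁻¹ * x₂ * x₃ = x₄ * x₁ * x₄⁻¹ * x₃ * x₄)
    (hirr₁₂₃ : IsIrreducibleFamily ![(x₁ : 𝕄), (x₂ : 𝕄), (x₃ : 𝕄)])
    (hirr₁₂₄ : IsIrreducibleFamily ![(x₁ : 𝕄), (x₂ : 𝕄), (x₄ : 𝕄)])
    (hirr₁₃₄ : IsIrreducibleFamily ![(x₁ : 𝕄), (x₃ : 𝕄), (x₄ : 𝕄)])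
    (hirr₂₃₄ : IsIrreducibleFamily ![(x₂ : 𝕄), (x₃ : 𝕄), (x₄ : 𝕄)])
    (ht₁₂ : ((x₁ * x₂ : SL2) : 𝕄).trace ≠ 1) (ht₂₃ : ((x₂ * x₃ : SL2) : 𝕄).trace ≠ 1)
    (ht₃₄ : ((x₃ * x₄ : SL2) : 𝕄).trace ≠ 1) (ht₄₁ : ((x₄ * x₁ : SL2) : 𝕄).trace ≠ 1)
    (h : ((x₁ * x₃ : SL2) : 𝕄).trace ≠ ((x₂ * x₄ : SL2) : 𝕄).trace)
    (h14 : ((x₁ * x₄ : SL2) : 𝕄).trace = ((x₁ * x₂ : SL2) : 𝕄).trace)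
    (h34 : ((x₃ * x₄ : SL2) : 𝕄).trace = ((x₂ * x₃ : SL2) : 𝕄).trace)
    (α μ : ℂ) (hα : α = t ^ 2 - 1)
    (hμ : μ = ((x₁ * x₂ : SL2) : 𝕄).trace + ((x₂ * x₃ : SL2) : 𝕄).trace - 2) :
    μ ^ 2 + (α ^ 2 - 4 * α) * μ + 4 * α ^ 2 - α ^ 3 = 0 := by
  obtain ⟨X1, e1, n1⟩ := mat_of t x₁ hx₁
  obtain ⟨X2, e2, n2⟩ := mat_of t x₂ hx₂
  obtain ⟨X3, e3, n3⟩ := mat_of t x₃ hx₃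
  obtain ⟨X4, e4, n4⟩ := mat_of t x₄ hx₄
  obtain ⟨s12, u12, v12, w12⟩ := r_eq (t / 2) X1 X2 X4 X2 X3 X1 _ _ _ _ _ _ e1 e2 e4 e2 e3 e1 hr₁₂
  obtain ⟨s23, u23, v23, w23⟩ := r_eq (t / 2) X2 X3 X1 X3 X4 X2 _ _ _ _ _ _ e2 e3 e1 e3 e4 e2 hr₂₃
  obtain ⟨s34, u34, v34, w34⟩ := r_eq (t / 2) X3 X4 X2 X4 X1 X3 _ _ _ _ _ _ e3 e4 e2 e4 e1 e3 hr₃₄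
  simp only [Matrix.SpecialLinearGroup.coe_mul, e1, e2, e3, e4, trace_mat] at ht₁₂ ht₂₃ h h14 h34 hμ
  have hg := core (t / 2) X1 X2 X3 X4 n1 n2 n3 n4 (by linear_combination (-1 / 2) * h14)
    (by linear_combination (-1 / 2) * h34) s12 s23 s34 u12 u23 u34 v12 v23 v34 w12 w23 w34
    (t ^ 2) _ _ _ _ (by ring) rfl rfl rfl rfl ht₁₂ ht₂₃ h
  rw [hμ, hα]
  linear_combination hg
end

section
/- Let t ∈ ℂ with t ≠ 0, and let x₁, x₂, x₃, x₄ ∈ SL(2,ℂ) with tr(xᵢ) = t for all i, such that r₁ = r₂ = r₃ = r₄ where rᵢ = xᵢxᵢ₊₁xᵢ⁻¹xᵢ₋₁xᵢ (subscripts modulo 4), each of the triples (x₁,x₂,x₃), (x₁,x₂,x₄), (x₁,x₃,x₄), (x₂,x₃,x₄) is irreducible, tr(xᵢxᵢ₊₁) ≠ 1 for all i (subscripts modulo 4), tr(x₁x₃) = tr(x₂x₄), tr(x₁x₄) = tr(x₂x₃), and tr(x₁x₂) ≠ tr(x₃x₄). Then tr(x₁x₂) ≠ t² − 2, tr(x₂x₃)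 ≠ t² − 2, and tr(x₃x₄) ≠ t² − 2. -/
open Matrix

local notation "𝕄" => Matrix (Fin 2) (Fin 2) ℂ
local notation "SL2" => Matrix.SpecialLinearGroup (Fin 2) ℂ

lemma aux_tri (A B C : SL2) (hA : A.1 1 0 = 0) (hB : B.1 1 0 = 0) (h : A.1 0 0 = B.1 0 0) :
    (A * B * A⁻¹ * C * A : SL2).1 1 0 = C.1 1 0 := by
  have dA := A.2
  have dB := B.2
  rw [Matrix.det_fin_two] at dA dB
  simp only [Matrix.SpecialLinearGroup.coe_mul, Matrix.SpecialLinearGroup.coe_inv,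
    Matrix.adjugate_fin_two, Matrix.mul_apply, Fin.sum_univ_two, Matrix.of_apply,
    Matrix.cons_val', Matrix.cons_val_zero, Matrix.cons_val_one, Matrix.cons_val_fin_one]
  rw [hA] at dA ⊢
  rw [hB, ← h] at dB
  rw [hB]
  have e : B.1 1 1 = A.1 1 1 := by
    have h0 : A.1 0 0 ≠ 0 := by
      intro h0
      rw [h0] at dA
      simp at dA
    apply mul_left_cancel₀ h0
    linear_combination dB - dA
  rw [e]
  linear_combination (C.1 1 0) * (A.1 0 0 * A.1 1 1 + 1) * dA

lemma aux_tri2 (A B C : SL2) (hA : A.1 1 0 = 0) (hC : C.1 1 0 = 0) (h : A.1 0 0 = C.1 0 0) :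
    (A * B * A⁻¹ * C * A : SL2).1 1 0 = B.1 1 0 := by
  have dA := A.2
  rw [Matrix.det_fin_two] at dA
  simp only [Matrix.SpecialLinearGroup.coe_mul, Matrix.SpecialLinearGroup.coe_inv,
    Matrix.adjugate_fin_two, Matrix.mul_apply, Fin.sum_univ_two, Matrix.of_apply,
    Matrix.cons_val', Matrix.cons_val_zero, Matrix.cons_val_one, Matrix.cons_val_fin_one]
  rw [hA] at dA ⊢
  rw [hC, ← h]
  linear_combination (B.1 1 0) * (A.1 0 0 * A.1 1 1 + 1) * dA

lemma aux_col (v : Fin 2 → ℂ) (hv : v ≠ 0) : ∃ g : SL2, g.1 0 0 = v 0 ∧ g.1 1 0 = v 1 := by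
  by_cases h : v 0 = 0
  · have h1 : v 1 ≠ 0 := by
      intro h1
      apply hv
      ext i
      fin_cases i <;> simp [h, h1]
    refine ⟨⟨!![v 0, -(v 1)⁻¹; v 1, 0], ?_⟩, rfl, rfl⟩
    rw [Matrix.det_fin_two_of]
    field_simp
    ring
  · refine ⟨⟨!![v 0, 0; v 1, (v 0)⁻¹], ?_⟩, rfl, rfl⟩
    rw [Matrix.det_fin_two_of]
    field_simp
    ring

lemma aux_conj_entry (g x : SL2) : (g⁻¹ * x * g : SL2).1 1 0 =
      g.1 0 0 * (x.1 1 0 * g.1 0 0 + x.1 1 1 * g.1 1 0)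
      - g.1 1 0 * (x.1 0 0 * g.1 0 0 + x.1 0 1 * g.1 1 0) := by
  simp only [Matrix.SpecialLinearGroup.coe_mul, Matrix.SpecialLinearGroup.coe_inv,
    Matrix.adjugate_fin_two, Matrix.mul_apply, Fin.sum_univ_two, Matrix.of_apply,
    Matrix.cons_val', Matrix.cons_val_zero, Matrix.cons_val_one, Matrix.cons_val_fin_one]
  ring

lemma aux_eig (g x : SL2) (h : (g⁻¹ * x * g : SL2).1 1 0 = 0) :
    ∃ a : ℂ, (x : 𝕄).mulVec (fun i => g.1 i 0) = a • (fun i => g.1 i 0) := by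
  set y := g⁻¹ * x * g with hy
  have e : x * g = g * y := by rw [hy]; group
  have e' : x.1 * g.1 = g.1 * y.1 := congrArg Subtype.val e
  refine ⟨y.1 0 0, ?_⟩
  ext i
  have := congrFun (congrFun e' i) 0
  simp only [Matrix.mul_apply, Fin.sum_univ_two, h] at this
  simp only [Matrix.mulVec, dotProduct, Fin.sum_univ_two, Pi.smul_apply, smul_eq_mul]
  linear_combination this

lemma aux_irr (g x y z : SL2) (hirr : IsIrreducibleFamily ![(x : 𝕄), (y : 𝕄), (z : 𝕄)])
    (hx : (g⁻¹ * x * g : SL2).1 1 0 = 0) (hy : (g⁻¹ * y * g : SL2).1 1 0 = 0)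
    (hz : (g⁻¹ * z * g : SL2).1 1 0 = 0) : False := by
  apply hirr
  refine ⟨fun i => g.1 i 0, ?_, ?_⟩
  · intro h
    have d := g.2
    rw [Matrix.det_fin_two] at d
    have h0 := congrFun h 0
    have h1 := congrFun h 1
    simp only [Pi.zero_apply] at h0 h1
    rw [h0, h1] at d
    simp at d
  · intro i
    fin_cases i
    · exact aux_eig g x hx
    · exact aux_eig g y hy
    · exact aux_eig g z hz

lemma aux_tr_conj (g x : SL2) : (g⁻¹ * x * g : SL2).1.trace = x.1.trace := by
  rw [Matrix.SpecialLinearGroup.coe_mul, Matrix.trace_mul_comm,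
    ← Matrix.SpecialLinearGroup.coe_mul, ← mul_assoc, mul_inv_cancel, one_mul]

lemma aux_sub (x y : SL2) (t : ℂ) (hx : x.1.trace = t) (hy : y.1.trace = t)
    (h : (x * y : SL2).1.trace = t ^ 2 - 2) : (x.1 - y.1).det = 0 := by
  have dx := x.2
  have dy := y.2
  rw [Matrix.det_fin_two] at dx dy
  simp only [Matrix.SpecialLinearGroup.coe_mul, Matrix.trace_fin_two, Matrix.mul_apply,
    Fin.sum_univ_two] at *
  simp only [Matrix.det_fin_two, Matrix.sub_apply]
  subst hx
  linear_combination dx + dy + h - (x.1 0 0 + x.1 1 1) * hy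

lemma aux_conj (x y : SL2) (t : ℂ) (hx : x.1.trace = t) (hy : y.1.trace = t)
    (h : (x * y : SL2).1.trace = t ^ 2 - 2) (hne : x ≠ y) :
    ∃ g : SL2, (g⁻¹ * x * g : SL2).1 1 0 = 0 ∧ (g⁻¹ * y * g : SL2).1 1 0 = 0 ∧
      (g⁻¹ * x * g : SL2).1 0 0 = (g⁻¹ * y * g : SL2).1 0 0 ∧
      (g⁻¹ * x * g : SL2).1 1 1 = (g⁻¹ * y * g : SL2).1 1 1 ∧
      (g⁻¹ * x * g : SL2).1 0 1 ≠ (g⁻¹ * y * g : SL2).1 0 1 := by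
  obtain ⟨v, hv, hv0⟩ := Matrix.exists_mulVec_eq_zero_iff.mpr (aux_sub x y t hx hy h)
  obtain ⟨g, h0, h1⟩ := aux_col v hv
  refine ⟨g, ?_⟩
  have e : (x.1 - y.1) * g.1 = g.1 * ((g⁻¹ * x * g : SL2).1 - (g⁻¹ * y * g : SL2).1) := by
    rw [Matrix.sub_mul, Matrix.mul_sub]
    simp only [← Matrix.SpecialLinearGroup.coe_mul]
    simp only [← mul_assoc, mul_inv_cancel, one_mul]
  have hxy : g⁻¹ * x * g ≠ g⁻¹ * y * g := by
    intro hh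
    exact hne (mul_left_cancel (mul_right_cancel hh))
  have tx := aux_tr_conj g x
  have ty := aux_tr_conj g y
  generalize g⁻¹ * x * g = X at *
  generalize g⁻¹ * y * g = Y at *
  rw [hx] at tx
  rw [hy] at ty
  have dg := g.2
  have dX := X.2
  have dY := Y.2
  rw [Matrix.det_fin_two] at dg dX dY
  have a0 := congrFun hv0 0
  have a1 := congrFun hv0 1
  have b0 := congrFun (congrFun e 0) 0
  have b1 := congrFun (congrFun e 1) 0
  simp only [Matrix.mulVec, dotProduct, Fin.sum_univ_two, Pi.zero_apply, Matrix.sub_apply,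
    Matrix.mul_apply, ← h0, ← h1] at a0 a1 b0 b1
  rw [a0] at b0
  rw [a1] at b1
  rw [Matrix.trace_fin_two] at tx ty
  have c0 : X.1 0 0 = Y.1 0 0 := by
    linear_combination -(X.1 0 0 - Y.1 0 0) * dg - g.1 1 1 * b0 + g.1 0 1 * b1
  have c1 : X.1 1 0 = Y.1 1 0 := by
    linear_combination -(X.1 1 0 - Y.1 1 0) * dg + g.1 1 0 * b0 - g.1 0 0 * b1
  have c2 : X.1 1 1 = Y.1 1 1 := by linear_combination tx - ty - c0
  have c3 : X.1 0 1 ≠ Y.1 0 1 := by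
    intro c3
    apply hxy
    ext i j
    fin_cases i <;> fin_cases j <;> assumption
  have c4 : Y.1 1 0 = 0 := by
    have : (X.1 0 1 - Y.1 0 1) * Y.1 1 0 = 0 := by
      rw [c0, c1, c2] at dX
      linear_combination dY - dX
    exact (mul_eq_zero.mp this).resolve_left (sub_ne_zero.mpr c3)
  exact ⟨c1.trans c4, c4, c0, c2, c3⟩

lemma aux_r (g A B C D E F : SL2) (h : A * B * A⁻¹ * C * A = D * E * D⁻¹ * F * D) :
    (g⁻¹ * A * g) * (g⁻¹ * B * g) * (g⁻¹ * A * g)⁻¹ * (g⁻¹ * C * g) * (g⁻¹ * A * g) =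
    (g⁻¹ * D * g) * (g⁻¹ * E * g) * (g⁻¹ * D * g)⁻¹ * (g⁻¹ * F * g) * (g⁻¹ * D * g) := by
  have e : ∀ A B C : SL2, (g⁻¹ * A * g) * (g⁻¹ * B * g) * (g⁻¹ * A * g)⁻¹ * (g⁻¹ * C * g) *
      (g⁻¹ * A * g) = g⁻¹ * (A * B * A⁻¹ * C * A) * g := by
    intro A B C
    group
  rw [e, e, h]

lemma aux_t (g A B C D : SL2) (h : (A * B : SL2).1.trace = (C * D : SL2).1.trace) :
    ((g⁻¹ * A * g) * (g⁻¹ * B * g) : SL2).1.trace =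
    ((g⁻¹ * C * g) * (g⁻¹ * D * g) : SL2).1.trace := by
  have e : ∀ A B : SL2, (g⁻¹ * A * g) * (g⁻¹ * B * g) = g⁻¹ * (A * B) * g := by
    intro A B
    group
  rw [e, e, aux_tr_conj, aux_tr_conj, h]

lemma aux_sq (x y : SL2) (h : x.1.trace = y.1.trace) :
    (x * x : SL2).1.trace = (y * y : SL2).1.trace := by
  have dx := x.2
  have dy := y.2
  rw [Matrix.det_fin_two] at dx dy
  simp only [Matrix.SpecialLinearGroup.coe_mul, Matrix.trace_fin_two, Matrix.mul_apply,
    Fin.sum_univ_two] at *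
  linear_combination (x.1 0 0 + x.1 1 1 + y.1 0 0 + y.1 1 1) * h - 2 * dx + 2 * dy

/-- First case: `tr(x₁x₂) ≠ t² - 2`. -/
lemma caseA (t : ℂ) (x₁ x₂ x₃ x₄ : SL2)
    (hx₁ : ((x₁ : 𝕄)).trace = t) (hx₂ : ((x₂ : 𝕄)).trace = t)
    (hx₃ : ((x₃ : 𝕄)).trace = t)
    (hr₁₂ : x₁ * x₂ * x₁⁻¹ * x₄ * x₁ = x₂ * x₃ * x₂⁻¹ * x₁ * x₂)
    (hirr₁₂₃ : IsIrreducibleFamily ![(x₁ : 𝕄), (x₂ : 𝕄), (x₃ : 𝕄)])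
    (h1324 : ((x₁ * x₃ : SL2) : 𝕄).trace = ((x₂ * x₄ : SL2) : 𝕄).trace)
    (h1423 : ((x₁ * x₄ : SL2) : 𝕄).trace = ((x₂ * x₃ : SL2) : 𝕄).trace)
    (h1234 : ((x₁ * x₂ : SL2) : 𝕄).trace ≠ ((x₃ * x₄ : SL2) : 𝕄).trace) :
    ((x₁ * x₂ : SL2) : 𝕄).trace ≠ t ^ 2 - 2 := by
  intro h
  by_cases hne : x₁ = x₂
  · subst hne
    have e : x₄ = x₃ := by
      have : x₁ * x₄ * x₁ = x₁ * x₃ * x₁ := by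
        calc x₁ * x₄ * x₁ = x₁ * x₁ * x₁⁻¹ * x₄ * x₁ := by group
          _ = _ := hr₁₂
          _ = _ := by group
      exact mul_left_cancel (mul_right_cancel this)
    subst e
    exact h1234 (aux_sq _ _ (hx₁.trans hx₃.symm))
  · obtain ⟨g, a1, a2, a3, a4, a5⟩ := aux_conj x₁ x₂ t hx₁ hx₂ h hne
    have hr := congrArg (fun z : SL2 => z.1 1 0) (aux_r g _ _ _ _ _ _ hr₁₂)
    rw [aux_tri _ _ _ a1 a2 a3, aux_tri2 _ _ _ a2 a1 a3.symm] at hr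
    have t1 := aux_t g _ _ _ _ h1324
    have t2 := aux_t g _ _ _ _ h1423
    refine aux_irr g _ _ _ hirr₁₂₃ a1 a2 ?_
    generalize g⁻¹ * x₁ * g = y₁ at *
    generalize g⁻¹ * x₂ * g = y₂ at *
    generalize g⁻¹ * x₃ * g = y₃ at *
    generalize g⁻¹ * x₄ * g = y₄ at *
    simp only [Matrix.SpecialLinearGroup.coe_mul, Matrix.trace_fin_two,
      Matrix.mul_apply, Fin.sum_univ_two] at t1 t2
    rw [a1, a2, a3, a4, hr] at t1
    rw [a1, a2, a3, a4, hr] at t2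
    have : (y₁.1 0 1 - y₂.1 0 1) * y₃.1 1 0 = 0 := by
      linear_combination (t1 + t2) / 2
    exact (mul_eq_zero.mp this).resolve_left (sub_ne_zero.mpr a5)

/-- Second case: `tr(x₂x₃) ≠ t² - 2`. -/
lemma caseB (t : ℂ) (x₁ x₂ x₃ x₄ : SL2)
    (hx₁ : ((x₁ : 𝕄)).trace = t) (hx₂ : ((x₂ : 𝕄)).trace = t)
    (hx₃ : ((x₃ : 𝕄)).trace = t) (hx₄ : ((x₄ : 𝕄)).trace = t)
    (hr₁₄ : x₄ * x₁ * x₄⁻¹ * x₃ * x₄ = x₁ * x₂ * x₁⁻¹ * x₄ * x₁)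
    (hr₂₃ : x₂ * x₃ * x₂⁻¹ * x₁ * x₂ = x₃ * x₄ * x₃⁻¹ * x₂ * x₃)
    (hirr₁₂₃ : IsIrreducibleFamily ![(x₁ : 𝕄), (x₂ : 𝕄), (x₃ : 𝕄)])
    (h1423 : ((x₁ * x₄ : SL2) : 𝕄).trace = ((x₂ * x₃ : SL2) : 𝕄).trace)
    (h1234 : ((x₁ * x₂ : SL2) : 𝕄).trace ≠ ((x₃ * x₄ : SL2) : 𝕄).trace) :
    ((x₂ * x₃ : SL2) : 𝕄).trace ≠ t ^ 2 - 2 := by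
  intro h
  have key : x₁ = x₄ → x₂ = x₃ → False := by
    rintro rfl rfl
    apply h1234
    rw [Matrix.SpecialLinearGroup.coe_mul, Matrix.trace_mul_comm,
      ← Matrix.SpecialLinearGroup.coe_mul]
  by_cases hne : x₂ = x₃
  · refine key ?_ hne
    subst hne
    have : x₂ * x₁ * x₂ = x₂ * x₄ * x₂ := by
      calc x₂ * x₁ * x₂ = x₂ * x₂ * x₂⁻¹ * x₁ * x₂ := by group
        _ = _ := hr₂₃
        _ = _ := by group
    exact mul_left_cancel (mul_right_cancel this)
  by_cases hne' : x₁ = x₄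
  · refine key hne' ?_
    subst hne'
    have : x₁ * x₃ * x₁ = x₁ * x₂ * x₁ := by
      calc x₁ * x₃ * x₁ = x₁ * x₁ * x₁⁻¹ * x₃ * x₁ := by group
        _ = _ := hr₁₄
        _ = _ := by group
    exact (mul_left_cancel (mul_right_cancel this)).symm
  obtain ⟨g, a1, a2, a3, a4, a5⟩ := aux_conj x₂ x₃ t hx₂ hx₃ h hne
  have hr := congrArg (fun z : SL2 => z.1 1 0) (aux_r g _ _ _ _ _ _ hr₂₃)
  rw [aux_tri _ _ _ a1 a2 a3, aux_tri2 _ _ _ a2 a1 a3.symm] at hr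
  refine aux_irr g _ _ _ hirr₁₂₃ ?_ a1 a2
  have hxy : g⁻¹ * x₁ * g ≠ g⁻¹ * x₄ * g := by
    intro hh
    exact hne' (mul_left_cancel (mul_right_cancel hh))
  have s1 := (aux_tr_conj g x₁).trans hx₁
  have s4 := (aux_tr_conj g x₄).trans hx₄
  have s14 : ((g⁻¹ * x₁ * g) * (g⁻¹ * x₄ * g) : SL2).1.trace = t ^ 2 - 2 := by
    exact (aux_t g x₁ x₄ x₂ x₃ h1423).trans ((aux_t g x₂ x₃ x₂ x₃ rfl).trans (by
      have e : (g⁻¹ * x₂ * g) * (g⁻¹ * x₃ * g) = g⁻¹ * (x₂ * x₃) * g := by group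
      rw [e, aux_tr_conj, h]))
  have hd := aux_sub _ _ t s1 s4 s14
  generalize g⁻¹ * x₁ * g = X at *
  generalize g⁻¹ * x₄ * g = Y at *
  have dX := X.2
  have dY := Y.2
  rw [Matrix.det_fin_two] at hd dX dY
  rw [Matrix.trace_fin_two] at s1 s4
  simp only [Matrix.sub_apply] at hd
  have c0 : X.1 0 0 = Y.1 0 0 := by
    have : (X.1 0 0 - Y.1 0 0) ^ 2 = 0 := by
      linear_combination (X.1 0 0 - Y.1 0 0) * (s1 - s4) - hd - (X.1 0 1 - Y.1 0 1) * hr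
    exact sub_eq_zero.mp (pow_eq_zero_iff (two_ne_zero)|>.mp this)
  have c2 : X.1 1 1 = Y.1 1 1 := by linear_combination s1 - s4 - c0
  have c3 : X.1 0 1 ≠ Y.1 0 1 := by
    intro c3
    apply hxy
    ext i j
    fin_cases i <;> fin_cases j <;> assumption
  have : (X.1 0 1 - Y.1 0 1) * X.1 1 0 = 0 := by
    rw [← c0, ← hr, ← c2] at dY
    linear_combination dY - dX
  exact (mul_eq_zero.mp this).resolve_left (sub_ne_zero.mpr c3)

/-- In the situation of STATEMENT 15 with `t ≠ 0`, none of
`tr(x₁x₂)`, `tr(x₂x₃)`, `tr(x₃x₄)` equals `t² − 2`. -/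
theorem stmt16 (t : ℂ) (ht : t ≠ 0) (x₁ x₂ x₃ x₄ : SL2)
    (hx₁ : ((x₁ : 𝕄)).trace = t) (hx₂ : ((x₂ : 𝕄)).trace = t)
    (hx₃ : ((x₃ : 𝕄)).trace = t) (hx₄ : ((x₄ : 𝕄)).trace = t)
    (hr₁₂ : x₁ * x₂ * x₁⁻¹ * x₄ * x₁ = x₂ * x₃ * x₂⁻¹ * x₁ * x₂)
    (hr₂₃ : x₂ * x₃ * x₂⁻¹ * x₁ * x₂ = x₃ * x₄ * x₃⁻¹ * x₂ * x₃)
    (hr₃₄ : x₃ * x₄ * x₃⁻¹ * x₂ * x₃ = x₄ * x₁ * x₄⁻¹ * x₃ * x₄)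
    (hirr₁₂₃ : IsIrreducibleFamily ![(x₁ : 𝕄), (x₂ : 𝕄), (x₃ : 𝕄)])
    (hirr₁₂₄ : IsIrreducibleFamily ![(x₁ : 𝕄), (x₂ : 𝕄), (x₄ : 𝕄)])
    (hirr₁₃₄ : IsIrreducibleFamily ![(x₁ : 𝕄), (x₃ : 𝕄), (x₄ : 𝕄)])
    (hirr₂₃₄ : IsIrreducibleFamily ![(x₂ : 𝕄), (x₃ : 𝕄), (x₄ : 𝕄)])
    (ht₁₂ : ((x₁ * x₂ : SL2) : 𝕄).trace ≠ 1) (ht₂₃ : ((x₂ * x₃ : SL2) : 𝕄).trace ≠ 1)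
    (ht₃₄ : ((x₃ * x₄ : SL2) : 𝕄).trace ≠ 1) (ht₄₁ : ((x₄ * x₁ : SL2) : 𝕄).trace ≠ 1)
    (h1324 : ((x₁ * x₃ : SL2) : 𝕄).trace = ((x₂ * x₄ : SL2) : 𝕄).trace)
    (h1423 : ((x₁ * x₄ : SL2) : 𝕄).trace = ((x₂ * x₃ : SL2) : 𝕄).trace)
    (h1234 : ((x₁ * x₂ : SL2) : 𝕄).trace ≠ ((x₃ * x₄ : SL2) : 𝕄).trace) :
    ((x₁ * x₂ : SL2) : 𝕄).trace ≠ t ^ 2 - 2 ∧ ((x₂ * x₃ : SL2) : 𝕄).trace ≠ t ^ 2 - 2 ∧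
    ((x₃ * x₄ : SL2) : 𝕄).trace ≠ t ^ 2 - 2 := by
  have hirr₃₄₁ : IsIrreducibleFamily ![(x₃ : 𝕄), (x₄ : 𝕄), (x₁ : 𝕄)] := by
    rintro ⟨v, hv, h⟩
    refine hirr₁₃₄ ⟨v, hv, ?_⟩
    intro i
    fin_cases i
    · exact h 2
    · exact h 0
    · exact h 1
  have comm : ∀ a b : SL2, ((a * b : SL2) : 𝕄).trace = ((b * a : SL2) : 𝕄).trace := by
    intro a b
    rw [Matrix.SpecialLinearGroup.coe_mul, Matrix.trace_mul_comm,
      ← Matrix.SpecialLinearGroup.coe_mul]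
  refine ⟨caseA t x₁ x₂ x₃ x₄ hx₁ hx₂ hx₃ hr₁₂ hirr₁₂₃ h1324 h1423 h1234,
    caseB t x₁ x₂ x₃ x₄ hx₁ hx₂ hx₃ hx₄ (hr₁₂.trans (hr₂₃.trans hr₃₄)).symm hr₂₃ hirr₁₂₃
      h1423 h1234,
    caseA t x₃ x₄ x₁ x₂ hx₃ hx₄ hx₁ hr₃₄ hirr₃₄₁ ?_ ?_ h1234.symm⟩
  · rw [comm x₃ x₁, comm x₄ x₂, h1324]
  · rw [comm x₃ x₂, comm x₄ x₁, h1423]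
end

section
/- Let t ∈ ℂ and let x₁, x₂, x₃, x₄ ∈ SL(2,ℂ) with tr(xᵢ) = t for all i, such that r₁ = r₂ = r₃ = r₄ where rᵢ = xᵢxᵢ₊₁xᵢ⁻¹xᵢ₋₁xᵢ (subscripts modulo 4), each of the triples (x₁,x₂,x₃), (x₁,x₂,x₄), (x₁,x₃,x₄), (x₂,x₃,x₄) is irreducible, tr(xᵢxᵢ₊₁) ≠ 1 for all i (subscripts modulo 4), tr(x₁x₃) = tr(x₂x₄), tr(x₁x₄) = tr(x₂x₃), and tr(x₁x₂) = tr(x₃x₄). Then tr(x₁x₂) = tr(x₂x₃) (so all four traces tr(xᵢxᵢ₊₁) are equal). -/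
open Matrix

local notation "𝕄" => Matrix (Fin 2) (Fin 2) ℂ
local notation "SL2" => Matrix.SpecialLinearGroup (Fin 2) ℂ

set_option maxHeartbeats 4000000

/-- The matrix with half-trace `h` and traceless part `(p, q, r)`. -/
def M (h p q r : ℂ) : Matrix (Fin 2) (Fin 2) ℂ := !![h + p, q; r, h - p]

/-- Gram data of three traceless matrices. -/
def Gram (p1 q1 r1 p2 q2 r2 p3 q3 r3 d1 d2 d3 A B C s : ℂ) : Prop :=
  d1 = p1 * p1 + q1 * r1 ∧ d2 = p2 * p2 + q2 * r2 ∧ d3 = p3 * p3 + q3 * r3 ∧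
  A = p1 * p2 + (q1 * r2 + r1 * q2) / 2 ∧ B = p2 * p3 + (q2 * r3 + r2 * q3) / 2 ∧
  C = p1 * p3 + (q1 * r3 + r1 * q3) / 2 ∧
  s = (M 0 p1 q1 r1 * M 0 p2 q2 r2 * M 0 p3 q3 r3).trace / 2

theorem idn_13_1_Y1 (h p1 q1 r1 p2 q2 r2 p3 q3 r3 d1 d2 d3 A B C s : ℂ)
    (hG : Gram p1 q1 r1 p2 q2 r2 p3 q3 r3 d1 d2 d3 A B C s)
    (hD : (M h p1 q1 r1) * (M h p2 q2 r2) * adjugate (M h p1 q1 r1) * (M h (p1+p3-p2) (q1+q3-q2) (r1+r3-r2)) * (M h p1 q1 r1)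
      = (M h p2 q2 r2) * (M h p3 q3 r3) * adjugate (M h p2 q2 r2) * (M h p1 q1 r1) * (M h p2 q2 r2)) :
    4*h^4*s - 8*h^2*d1*s - 8*h^2*d2*s + 8*h^2*A*s + 16*h^2*B*s - 4*h*d1*d2*d3 - 4*h*d1*d2*C - 4*h*d1*d3*A + 4*h*d1*A*B + 4*h*d1*B^2 + 4*h*d1*B*C - 4*h*d2^2*d3 + 4*h*d2^2*C + 4*h*d2*d3*A - 4*h*d2*A*B + 4*h*d2*B^2 - 4*h*d2*B*C + 8*h*d2*C^2 + 8*h*d3*A^2 - 16*h*A*B*C + 8*h*s^2 - 4*d1*d2*s - 8*d1*A*s + 4*d1*B*s - 4*d2*B*s + 16*A^2*s - 16*A*C*s = 0 := by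
  have hT := congrArg (fun Z => (Z * M 0 (q2 * r3 - q3 * r2) (2 * (p2 * q3 - q2 * p3)) (2 * (r2 * p3 - p2 * r3))).trace) hD
  obtain ⟨rfl, rfl, rfl, rfl, rfl, rfl, rfl⟩ := hG
  simp only [M, Matrix.adjugate_fin_two_of, Matrix.mul_fin_two, Matrix.trace_fin_two_of] at hT ⊢
  linear_combination hT

theorem idn_13_2_Y0 (h p1 q1 r1 p2 q2 r2 p3 q3 r3 d1 d2 d3 A B C s : ℂ)
    (hG : Gram p1 q1 r1 p2 q2 r2 p3 q3 r3 d1 d2 d3 A B C s)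
    (hD : (M h p2 q2 r2) * (M h p3 q3 r3) * adjugate (M h p2 q2 r2) * (M h p1 q1 r1) * (M h p2 q2 r2)
      = (M h p3 q3 r3) * (M h (p1+p3-p2) (q1+q3-q2) (r1+r3-r2)) * adjugate (M h p3 q3 r3) * (M h p2 q2 r2) * (M h p3 q3 r3)) :
    -4*h^4*s + 8*h^2*d2*s + 8*h^2*d3*s - 16*h^2*A*s - 8*h^2*B*s + 4*h*d1*d2^2 + 4*h*d1*d2*d3 - 4*h*d1*d2*B + 4*h*d1*d3*B - 8*h*d1*B^2 - 4*h*d2^2*C + 4*h*d2*d3*C - 4*h*d2*A^2 + 4*h*d2*A*B + 4*h*d2*A*C - 8*h*d2*C^2 - 4*h*d3*A^2 - 4*h*d3*A*B - 4*h*d3*A*C + 16*h*A*B*C - 8*h*s^2 + 4*d2*d3*s + 4*d2*A*s - 4*d3*A*s + 8*d3*B*s - 16*B^2*s + 16*B*C*s = 0 := by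
  have hT := congrArg (fun Z => (Z * M 0 (q1 * r2 - q2 * r1) (2 * (p1 * q2 - q1 * p2)) (2 * (r1 * p2 - p1 * r2))).trace) hD
  obtain ⟨rfl, rfl, rfl, rfl, rfl, rfl, rfl⟩ := hG
  simp only [M, Matrix.adjugate_fin_two_of, Matrix.mul_fin_two, Matrix.trace_fin_two_of] at hT ⊢
  linear_combination hT

theorem idn_13_1_X1 (h p1 q1 r1 p2 q2 r2 p3 q3 r3 d1 d2 d3 A B C s : ℂ)
    (hG : Gram p1 q1 r1 p2 q2 r2 p3 q3 r3 d1 d2 d3 A B C s)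
    (hD : (M h p1 q1 r1) * (M h p2 q2 r2) * adjugate (M h p1 q1 r1) * (M h (p1+p3-p2) (q1+q3-q2) (r1+r3-r2)) * (M h p1 q1 r1)
      = (M h p2 q2 r2) * (M h p3 q3 r3) * adjugate (M h p2 q2 r2) * (M h p1 q1 r1) * (M h p2 q2 r2)) :
    2*h^4*d1 - 2*h^4*A - 4*h^2*d1^2 - 4*h^2*d1*d2 + 2*h^2*d1*A + 8*h^2*d1*B - 2*h^2*d1*C + 2*h^2*d2*A + 2*h^2*d2*C + 4*h^2*A^2 - 8*h^2*A*C + 6*h*d1*s + 2*h*d2*s - 8*h*A*s - 2*d1^2*d2 - 2*d1^2*A + 2*d1^2*B - 2*d1*d2*B + 4*d1*A^2 - 4*d1*A*C - 4*d2*A*C + 8*A^2*B = 0 := by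
  have hT := congrArg (fun Z => (Z * M 0 p1 q1 r1).trace) hD
  obtain ⟨rfl, rfl, rfl, rfl, rfl, rfl, rfl⟩ := hG
  simp only [M, Matrix.adjugate_fin_two_of, Matrix.mul_fin_two, Matrix.trace_fin_two_of] at hT ⊢
  linear_combination hT

theorem idn_13_2_X1 (h p1 q1 r1 p2 q2 r2 p3 q3 r3 d1 d2 d3 A B C s : ℂ)
    (hG : Gram p1 q1 r1 p2 q2 r2 p3 q3 r3 d1 d2 d3 A B C s)
    (hD : (M h p2 q2 r2) * (M h p3 q3 r3) * adjugate (M h p2 q2 r2) * (M h p1 q1 r1) * (M h p2 q2 r2)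
      = (M h p3 q3 r3) * (M h (p1+p3-p2) (q1+q3-q2) (r1+r3-r2)) * adjugate (M h p3 q3 r3) * (M h p2 q2 r2) * (M h p3 q3 r3)) :
    2*h^4*A - 2*h^4*C - 2*h^2*d1*d2 + 2*h^2*d1*d3 - 2*h^2*d2*A + 4*h^2*d2*C + 2*h^2*d3*A + 4*h^2*d3*C - 4*h^2*A*B - 4*h^2*B*C - 2*h*d2*s + 2*h*d3*s + 8*h*A*s - 8*h*C*s + 2*d1*d2*B - 2*d1*d3*B + 2*d2*d3*C + 4*d2*A*C - 2*d3^2*A + 4*d3*A*B - 4*d3*A*C + 4*d3*B*C - 8*A^2*B - 8*B^2*C + 8*B*C^2 = 0 := by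
  have hT := congrArg (fun Z => (Z * M 0 p1 q1 r1).trace) hD
  obtain ⟨rfl, rfl, rfl, rfl, rfl, rfl, rfl⟩ := hG
  simp only [M, Matrix.adjugate_fin_two_of, Matrix.mul_fin_two, Matrix.trace_fin_two_of] at hT ⊢
  linear_combination hT

theorem idn_sum_1_1 (h p1 q1 r1 p2 q2 r2 p3 q3 r3 d1 d2 d3 A B C s : ℂ)
    (hG : Gram p1 q1 r1 p2 q2 r2 p3 q3 r3 d1 d2 d3 A B C s)
    (hD : (M h p1 q1 r1) * (M h p2 q2 r2) * adjugate (M h p1 q1 r1) * (M h (-p1-p2-p3) (-q1-q2-q3) (-r1-r2-r3)) * (M h p1 q1 r1)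
      = (M h p2 q2 r2) * (M h p3 q3 r3) * adjugate (M h p2 q2 r2) * (M h p1 q1 r1) * (M h p2 q2 r2)) :
    -4*h^3*d1 - 4*h^3*A - 4*h^3*B - 4*h^3*C - 12*h^2*s + 2*h*d1^2 - 6*h*d1*d2 + 2*h*d1*A - 6*h*d1*B + 2*h*d1*C + 2*h*d2*A + 2*h*d2*B - 6*h*d2*C + 8*h*A^2 + 8*h*A*B + 8*h*A*C - 2*d1*s - 2*d2*s = 0 := by
  have hT := congrArg (fun Z => (Z * M 1 0 0 0).trace) hD
  obtain ⟨rfl, rfl, rfl, rfl, rfl, rfl, rfl⟩ := hG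
  simp only [M, Matrix.adjugate_fin_two_of, Matrix.mul_fin_two, Matrix.trace_fin_two_of] at hT ⊢
  linear_combination hT

theorem idn_sum_1_Y0 (h p1 q1 r1 p2 q2 r2 p3 q3 r3 d1 d2 d3 A B C s : ℂ)
    (hG : Gram p1 q1 r1 p2 q2 r2 p3 q3 r3 d1 d2 d3 A B C s)
    (hD : (M h p1 q1 r1) * (M h p2 q2 r2) * adjugate (M h p1 q1 r1) * (M h (-p1-p2-p3) (-q1-q2-q3) (-r1-r2-r3)) * (M h p1 q1 r1)
      = (M h p2 q2 r2) * (M h p3 q3 r3) * adjugate (M h p2 q2 r2) * (M h p1 q1 r1) * (M h p2 q2 r2)) :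
    -8*h^4*s - 8*h^3*d1*d2 - 8*h^3*d1*B - 8*h^3*d2*C + 8*h^3*A^2 + 8*h^3*A*B + 8*h^3*A*C + 4*h^2*d1*s + 4*h^2*d2*s + 8*h^2*A*s + 12*h*d1^2*d2 + 4*h*d1^2*B - 4*h*d1*d2^2 + 4*h*d1*d2*B + 4*h*d1*d2*C - 12*h*d1*A^2 - 4*h*d1*A*B - 4*h*d1*A*C + 4*h*d2^2*C + 4*h*d2*A^2 - 4*h*d2*A*B - 4*h*d2*A*C - 4*d1*A*s - 4*d2*A*s = 0 := by
  have hT := congrArg (fun Z => (Z * M 0 (q1 * r2 - q2 * r1) (2 * (p1 * q2 - q1 * p2)) (2 * (r1 * p2 - p1 * r2))).trace) hD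
  obtain ⟨rfl, rfl, rfl, rfl, rfl, rfl, rfl⟩ := hG
  simp only [M, Matrix.adjugate_fin_two_of, Matrix.mul_fin_two, Matrix.trace_fin_two_of] at hT ⊢
  linear_combination hT

theorem idn_sum_2_Y1 (h p1 q1 r1 p2 q2 r2 p3 q3 r3 d1 d2 d3 A B C s : ℂ)
    (hG : Gram p1 q1 r1 p2 q2 r2 p3 q3 r3 d1 d2 d3 A B C s)
    (hD : (M h p2 q2 r2) * (M h p3 q3 r3) * adjugate (M h p2 q2 r2) * (M h p1 q1 r1) * (M h p2 q2 r2)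
      = (M h p3 q3 r3) * (M h (-p1-p2-p3) (-q1-q2-q3) (-r1-r2-r3)) * adjugate (M h p3 q3 r3) * (M h p2 q2 r2) * (M h p3 q3 r3)) :
    8*h^4*s + 8*h^3*d2*d3 + 8*h^3*d2*C + 8*h^3*d3*A - 8*h^3*A*B - 8*h^3*B^2 - 8*h^3*B*C - 4*h^2*d2*s - 4*h^2*d3*s - 8*h^2*B*s + 4*h*d2^2*d3 - 4*h*d2^2*C - 12*h*d2*d3^2 - 4*h*d2*d3*A - 4*h*d2*d3*C + 4*h*d2*A*B - 4*h*d2*B^2 + 4*h*d2*B*C - 4*h*d3^2*A + 4*h*d3*A*B + 12*h*d3*B^2 + 4*h*d3*B*C + 4*d2*B*s + 4*d3*B*s = 0 := by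
  have hT := congrArg (fun Z => (Z * M 0 (q2 * r3 - q3 * r2) (2 * (p2 * q3 - q2 * p3)) (2 * (r2 * p3 - p2 * r3))).trace) hD
  obtain ⟨rfl, rfl, rfl, rfl, rfl, rfl, rfl⟩ := hG
  simp only [M, Matrix.adjugate_fin_two_of, Matrix.mul_fin_two, Matrix.trace_fin_two_of] at hT ⊢
  linear_combination hT

theorem idn_sum_1_X1 (h p1 q1 r1 p2 q2 r2 p3 q3 r3 d1 d2 d3 A B C s : ℂ)
    (hG : Gram p1 q1 r1 p2 q2 r2 p3 q3 r3 d1 d2 d3 A B C s)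
    (hD : (M h p1 q1 r1) * (M h p2 q2 r2) * adjugate (M h p1 q1 r1) * (M h (-p1-p2-p3) (-q1-q2-q3) (-r1-r2-r3)) * (M h p1 q1 r1)
      = (M h p2 q2 r2) * (M h p3 q3 r3) * adjugate (M h p2 q2 r2) * (M h p1 q1 r1) * (M h p2 q2 r2)) :
    -2*h^4*d1 - 2*h^4*A - 4*h^4*C - 4*h^3*s - 4*h^2*d1*d2 - 2*h^2*d1*A - 4*h^2*d1*B + 2*h^2*d1*C + 2*h^2*d2*A + 2*h^2*d2*C + 4*h^2*A^2 - 6*h*d1*s + 2*h*d2*s - 8*h*A*s - 2*d1^2*d2 + 2*d1^2*A - 2*d1^2*B - 2*d1*d2*B + 4*d1*A^2 + 4*d1*A*C - 4*d2*A*C + 8*A^2*B = 0 := by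
  have hT := congrArg (fun Z => (Z * M 0 p1 q1 r1).trace) hD
  obtain ⟨rfl, rfl, rfl, rfl, rfl, rfl, rfl⟩ := hG
  simp only [M, Matrix.adjugate_fin_two_of, Matrix.mul_fin_two, Matrix.trace_fin_two_of] at hT ⊢
  linear_combination hT

theorem idn_sum_2_X2 (h p1 q1 r1 p2 q2 r2 p3 q3 r3 d1 d2 d3 A B C s : ℂ)
    (hG : Gram p1 q1 r1 p2 q2 r2 p3 q3 r3 d1 d2 d3 A B C s)
    (hD : (M h p2 q2 r2) * (M h p3 q3 r3) * adjugate (M h p2 q2 r2) * (M h p1 q1 r1) * (M h p2 q2 r2)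
      = (M h p3 q3 r3) * (M h (-p1-p2-p3) (-q1-q2-q3) (-r1-r2-r3)) * adjugate (M h p3 q3 r3) * (M h p2 q2 r2) * (M h p3 q3 r3)) :
    2*h^4*d2 + 4*h^4*A + 2*h^4*B + 4*h^3*s - 2*h^2*d2^2 - 2*h^2*d2*d3 - 2*h^2*d2*A + 4*h^2*d2*C - 2*h^2*d3*A + 4*h^2*B^2 + 6*h*d2*s - 2*h*d3*s + 8*h*B*s + 2*d2^2*C + 2*d2*d3^2 + 6*d2*d3*B + 2*d2*d3*C - 4*d2*A*B + 4*d3*A*B - 4*d3*B^2 - 8*B^3 - 8*B^2*C = 0 := by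
  have hT := congrArg (fun Z => (Z * M 0 p2 q2 r2).trace) hD
  obtain ⟨rfl, rfl, rfl, rfl, rfl, rfl, rfl⟩ := hG
  simp only [M, Matrix.adjugate_fin_two_of, Matrix.mul_fin_two, Matrix.trace_fin_two_of] at hT ⊢
  linear_combination hT

theorem idn_12_1_1 (h p1 q1 r1 p2 q2 r2 p3 q3 r3 d1 d2 d3 A B C s : ℂ)
    (hG : Gram p1 q1 r1 p2 q2 r2 p3 q3 r3 d1 d2 d3 A B C s)
    (hD : (M h p1 q1 r1) * (M h p2 q2 r2) * adjugate (M h p1 q1 r1) * (M h (p1+p2-p3) (q1+q2-q3) (r1+r2-r3)) * (M h p1 q1 r1)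
      = (M h p2 q2 r2) * (M h p3 q3 r3) * adjugate (M h p2 q2 r2) * (M h p1 q1 r1) * (M h p2 q2 r2)) :
    4*h^3*d2 + 4*h^3*A - 4*h^3*B - 4*h^3*C - 12*h^2*s - 2*h*d1^2 + 6*h*d1*d2 - 6*h*d1*A - 6*h*d1*B + 2*h*d1*C + 2*h*d2*A + 2*h*d2*B - 6*h*d2*C - 8*h*A^2 + 8*h*A*B + 8*h*A*C - 2*d1*s - 2*d2*s = 0 := by
  have hT := congrArg (fun Z => (Z * M 1 0 0 0).trace) hD
  obtain ⟨rfl, rfl, rfl, rfl, rfl, rfl, rfl⟩ := hG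
  simp only [M, Matrix.adjugate_fin_two_of, Matrix.mul_fin_two, Matrix.trace_fin_two_of] at hT ⊢
  linear_combination hT

theorem idn_12_1_Y0 (h p1 q1 r1 p2 q2 r2 p3 q3 r3 d1 d2 d3 A B C s : ℂ)
    (hG : Gram p1 q1 r1 p2 q2 r2 p3 q3 r3 d1 d2 d3 A B C s)
    (hD : (M h p1 q1 r1) * (M h p2 q2 r2) * adjugate (M h p1 q1 r1) * (M h (p1+p2-p3) (q1+q2-q3) (r1+r2-r3)) * (M h p1 q1 r1)
      = (M h p2 q2 r2) * (M h p3 q3 r3) * adjugate (M h p2 q2 r2) * (M h p1 q1 r1) * (M h p2 q2 r2)) :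
    -8*h^4*s + 8*h^3*d1*d2 - 8*h^3*d1*B - 8*h^3*d2*C - 8*h^3*A^2 + 8*h^3*A*B + 8*h^3*A*C + 4*h^2*d1*s + 4*h^2*d2*s + 8*h^2*A*s - 4*h*d1^2*d2 + 4*h*d1^2*B - 4*h*d1*d2^2 + 4*h*d1*d2*B + 4*h*d1*d2*C + 4*h*d1*A^2 - 4*h*d1*A*B - 4*h*d1*A*C + 4*h*d2^2*C + 4*h*d2*A^2 - 4*h*d2*A*B - 4*h*d2*A*C - 4*d1*A*s - 4*d2*A*s = 0 := by
  have hT := congrArg (fun Z => (Z * M 0 (q1 * r2 - q2 * r1) (2 * (p1 * q2 - q1 * p2)) (2 * (r1 * p2 - p1 * r2))).trace) hD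
  obtain ⟨rfl, rfl, rfl, rfl, rfl, rfl, rfl⟩ := hG
  simp only [M, Matrix.adjugate_fin_two_of, Matrix.mul_fin_two, Matrix.trace_fin_two_of] at hT ⊢
  linear_combination hT

theorem idn_12_1_X1 (h p1 q1 r1 p2 q2 r2 p3 q3 r3 d1 d2 d3 A B C s : ℂ)
    (hG : Gram p1 q1 r1 p2 q2 r2 p3 q3 r3 d1 d2 d3 A B C s)
    (hD : (M h p1 q1 r1) * (M h p2 q2 r2) * adjugate (M h p1 q1 r1) * (M h (p1+p2-p3) (q1+q2-q3) (r1+r2-r3)) * (M h p1 q1 r1)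
      = (M h p2 q2 r2) * (M h p3 q3 r3) * adjugate (M h p2 q2 r2) * (M h p1 q1 r1) * (M h p2 q2 r2)) :
    2*h^4*d1 + 2*h^4*A - 4*h^4*C - 4*h^3*s - 4*h^2*d1^2 + 8*h^2*d1*d2 - 2*h^2*d1*A - 4*h^2*d1*B + 2*h^2*d1*C + 2*h^2*d2*A + 2*h^2*d2*C - 4*h^2*A^2 - 6*h*d1*s + 2*h*d2*s - 8*h*A*s + 2*d1^2*d2 - 2*d1^2*A - 2*d1^2*B - 2*d1*d2*B - 4*d1*A^2 + 4*d1*A*C - 4*d2*A*C + 8*A^2*B = 0 := by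
  have hT := congrArg (fun Z => (Z * M 0 p1 q1 r1).trace) hD
  obtain ⟨rfl, rfl, rfl, rfl, rfl, rfl, rfl⟩ := hG
  simp only [M, Matrix.adjugate_fin_two_of, Matrix.mul_fin_two, Matrix.trace_fin_two_of] at hT ⊢
  linear_combination hT

theorem idn_12_2_X1 (h p1 q1 r1 p2 q2 r2 p3 q3 r3 d1 d2 d3 A B C s : ℂ)
    (hG : Gram p1 q1 r1 p2 q2 r2 p3 q3 r3 d1 d2 d3 A B C s)
    (hD : (M h p2 q2 r2) * (M h p3 q3 r3) * adjugate (M h p2 q2 r2) * (M h p1 q1 r1) * (M h p2 q2 r2)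
      = (M h p3 q3 r3) * (M h (p1+p2-p3) (q1+q2-q3) (r1+r2-r3)) * adjugate (M h p3 q3 r3) * (M h p2 q2 r2) * (M h p3 q3 r3)) :
    -2*h^4*A + 2*h^4*C - 2*h^2*d1*d2 + 2*h^2*d1*d3 - 2*h^2*d2*A - 8*h^2*d2*C + 2*h^2*d3*A + 4*h^2*A*B + 4*h^2*B*C - 2*h*d2*s + 2*h*d3*s + 8*h*A*s - 8*h*C*s + 2*d1*d2*B - 2*d1*d3*B - 2*d2*d3*C + 4*d2*A*C + 2*d3^2*A - 4*d3*A*B - 4*d3*A*C - 4*d3*B*C - 8*A^2*B + 8*B^2*C + 8*B*C^2 = 0 := by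
  have hT := congrArg (fun Z => (Z * M 0 p1 q1 r1).trace) hD
  obtain ⟨rfl, rfl, rfl, rfl, rfl, rfl, rfl⟩ := hG
  simp only [M, Matrix.adjugate_fin_two_of, Matrix.mul_fin_two, Matrix.trace_fin_two_of] at hT ⊢
  linear_combination hT

theorem gram_det (p1 q1 r1 p2 q2 r2 p3 q3 r3 d1 d2 d3 A B C s : ℂ)
    (hG : Gram p1 q1 r1 p2 q2 r2 p3 q3 r3 d1 d2 d3 A B C s) :
    s ^ 2 + (d1 * d2 * d3 + 2 * A * B * C - d1 * B ^ 2 - d2 * C ^ 2 - d3 * A ^ 2) = 0 := by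
  obtain ⟨rfl, rfl, rfl, rfl, rfl, rfl, rfl⟩ := hG
  simp only [M, Matrix.mul_fin_two, Matrix.trace_fin_two_of]
  ring

theorem case_13 (h p1 q1 r1 p2 q2 r2 p3 q3 r3 A B C s : ℂ)
    (hG : Gram p1 q1 r1 p2 q2 r2 p3 q3 r3 (h^2-1) (h^2-1) (h^2-1) A B C s)
    (hC : C = A + B - (h^2-1))
    (ha : 2 * (A + h^2) ≠ 1) (hb : 2 * (B + h^2) ≠ 1)
    (hD1 : M h p1 q1 r1 * M h p2 q2 r2 * adjugate (M h p1 q1 r1) *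
        M h (p1+p3-p2) (q1+q3-q2) (r1+r3-r2) * M h p1 q1 r1
      = M h p2 q2 r2 * M h p3 q3 r3 * adjugate (M h p2 q2 r2) * M h p1 q1 r1 * M h p2 q2 r2)
    (hD2 : M h p2 q2 r2 * M h p3 q3 r3 * adjugate (M h p2 q2 r2) * M h p1 q1 r1 * M h p2 q2 r2
      = M h p3 q3 r3 * M h (p1+p3-p2) (q1+q3-q2) (r1+r3-r2) * adjugate (M h p3 q3 r3) *
        M h p2 q2 r2 * M h p3 q3 r3) : A = B := by
  have e1 := idn_13_1_Y1 _ _ _ _ _ _ _ _ _ _ _ _ _ _ _ _ _ hG hD1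
  have e2 := idn_13_2_Y0 _ _ _ _ _ _ _ _ _ _ _ _ _ _ _ _ _ hG hD2
  have e3 := idn_13_1_X1 _ _ _ _ _ _ _ _ _ _ _ _ _ _ _ _ _ hG hD1
  have e4 := idn_13_2_X1 _ _ _ _ _ _ _ _ _ _ _ _ _ _ _ _ _ hG hD2
  have hs := gram_det _ _ _ _ _ _ _ _ _ _ _ _ _ _ _ _ hG
  clear hG hD1 hD2
  subst hC
  by_contra hne
  have hne' : A - B ≠ 0 := sub_ne_zero.mpr hne
  have h1 : s * (A - B) = 0 := by linear_combination (-1/8) * (e1 + e2)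
  have hs0 : s = 0 := (mul_eq_zero.mp h1).resolve_right hne'
  subst hs0
  have h2 : (A + B) * ((h^2-1-A) * (h^2-1-B)) = 0 := by linear_combination hs / 2
  have h3 : (A - B) * (4*h^4 - 4*h^2*(A+B) - 8*h^2 + 4*A*B + 2*(A+B) + 3) = 0 := by
    linear_combination (e3 - e4) / 2
  have h4 := (mul_eq_zero.mp h3).resolve_left hne'
  rcases mul_eq_zero.mp h2 with h5 | h5
  · have hB : B = -A := by linear_combination h5
    subst hB
    have : (1 : ℂ) = 0 := by
      linear_combination -1 * e3 + (2 * A - (2*h^2-1)) * h4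
    exact one_ne_zero this
  · rcases mul_eq_zero.mp h5 with h6 | h6
    · have hA : A = h^2-1 := by linear_combination -h6
      subst hA
      exact hb (by linear_combination -h4)
    · have hB : B = h^2-1 := by linear_combination -h6
      subst hB
      exact ha (by linear_combination -h4)

theorem case_sum (h p1 q1 r1 p2 q2 r2 p3 q3 r3 A B C s : ℂ)
    (hG : Gram p1 q1 r1 p2 q2 r2 p3 q3 r3 (h^2-1) (h^2-1) (h^2-1) A B C s)
    (hC : C = -(h^2-1) - A - B)
    (ha : 2 * (A + h^2) ≠ 1) (hb : 2 * (B + h^2) ≠ 1)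
    (hD1 : M h p1 q1 r1 * M h p2 q2 r2 * adjugate (M h p1 q1 r1) *
        M h (-p1-p2-p3) (-q1-q2-q3) (-r1-r2-r3) * M h p1 q1 r1
      = M h p2 q2 r2 * M h p3 q3 r3 * adjugate (M h p2 q2 r2) * M h p1 q1 r1 * M h p2 q2 r2)
    (hD2 : M h p2 q2 r2 * M h p3 q3 r3 * adjugate (M h p2 q2 r2) * M h p1 q1 r1 * M h p2 q2 r2
      = M h p3 q3 r3 * M h (-p1-p2-p3) (-q1-q2-q3) (-r1-r2-r3) * adjugate (M h p3 q3 r3) *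
        M h p2 q2 r2 * M h p3 q3 r3) : A = B := by
  have e2 := idn_sum_1_Y0 _ _ _ _ _ _ _ _ _ _ _ _ _ _ _ _ _ hG hD1
  have e3 := idn_sum_2_Y1 _ _ _ _ _ _ _ _ _ _ _ _ _ _ _ _ _ hG hD2
  have e4 := idn_sum_1_X1 _ _ _ _ _ _ _ _ _ _ _ _ _ _ _ _ _ hG hD1
  have e5 := idn_sum_2_X2 _ _ _ _ _ _ _ _ _ _ _ _ _ _ _ _ _ hG hD2
  have hs := gram_det _ _ _ _ _ _ _ _ _ _ _ _ _ _ _ _ hG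
  clear hG hD1 hD2
  subst hC
  by_contra hne
  have hne' : A - B ≠ 0 := sub_ne_zero.mpr hne
  have h1 : s * (A - B) = 0 := by linear_combination (1/8) * (e2 + e3)
  have hs0 : s = 0 := (mul_eq_zero.mp h1).resolve_right hne'
  subst hs0
  have h2 : (A + B) * ((h^2-1+A) * (h^2-1+B)) = 0 := by linear_combination -hs / 2
  have h3 : (A - B) * (4*h^4 + 4*h^2*(A+B) - 8*h^2 + 4*A*B - 2*(A+B) + 3) = 0 := by
    linear_combination (e4 - e5) / 2
  have h4 := (mul_eq_zero.mp h3).resolve_left hne'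
  rcases mul_eq_zero.mp h2 with h5 | h5
  · have hB : B = -A := by linear_combination h5
    subst hB
    grind
  · rcases mul_eq_zero.mp h5 with h6 | h6
    · have hA : A = 1-h^2 := by linear_combination h6
      subst hA
      have hB : B = h^2 - 1/2 := by linear_combination h4/2
      subst hB
      grind
    · have hB : B = 1-h^2 := by linear_combination h6
      subst hB
      have hA : A = h^2 - 1/2 := by linear_combination h4/2
      subst hA
      grind

theorem case_12 (h p1 q1 r1 p2 q2 r2 p3 q3 r3 A B C s : ℂ)
    (hG : Gram p1 q1 r1 p2 q2 r2 p3 q3 r3 (h^2-1) (h^2-1) (h^2-1) A B C s)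
    (hC : C = (h^2-1) + A - B)
    (ha : 2 * (A + h^2) ≠ 1) (hb : 2 * (B + h^2) ≠ 1)
    (hD1 : M h p1 q1 r1 * M h p2 q2 r2 * adjugate (M h p1 q1 r1) *
        M h (p1+p2-p3) (q1+q2-q3) (r1+r2-r3) * M h p1 q1 r1
      = M h p2 q2 r2 * M h p3 q3 r3 * adjugate (M h p2 q2 r2) * M h p1 q1 r1 * M h p2 q2 r2)
    (hD2 : M h p2 q2 r2 * M h p3 q3 r3 * adjugate (M h p2 q2 r2) * M h p1 q1 r1 * M h p2 q2 r2
      = M h p3 q3 r3 * M h (p1+p2-p3) (q1+q2-q3) (r1+r2-r3) * adjugate (M h p3 q3 r3) *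
        M h p2 q2 r2 * M h p3 q3 r3) : A = B := by
  have e1 := idn_12_1_1 _ _ _ _ _ _ _ _ _ _ _ _ _ _ _ _ _ hG hD1
  have e2 := idn_12_1_Y0 _ _ _ _ _ _ _ _ _ _ _ _ _ _ _ _ _ hG hD1
  have e3 := idn_12_1_X1 _ _ _ _ _ _ _ _ _ _ _ _ _ _ _ _ _ hG hD1
  have e4 := idn_12_2_X1 _ _ _ _ _ _ _ _ _ _ _ _ _ _ _ _ _ hG hD2
  have hs := gram_det _ _ _ _ _ _ _ _ _ _ _ _ _ _ _ _ hG
  clear hG hD1 hD2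
  subst hC
  by_contra hne
  have hne' : A - B ≠ 0 := sub_ne_zero.mpr hne
  have ha' : 2 * (A + h^2) - 1 ≠ 0 := sub_ne_zero.mpr ha
  have hb' : 2 * (B + h^2) - 1 ≠ 0 := sub_ne_zero.mpr hb
  have h0 : s * (4 * h^2 - 1) = 0 := by linear_combination (-1/4) * e1
  have h1 : s * (h^2 - A) = 0 := by linear_combination (-1/8) * e2
  have h1' : s * (2 * (A + h^2) - 1) = 0 := by linear_combination h0 - 2 * h1
  have hs0 : s = 0 := (mul_eq_zero.mp h1').resolve_right ha'
  subst hs0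
  have h2 : (A - B) * ((h^2-1+A) * (h^2-1-B)) = 0 := by linear_combination -hs / 2
  rcases mul_eq_zero.mp ((mul_eq_zero.mp h2).resolve_left hne') with h6 | h6
  · have hA : A = 1-h^2 := by linear_combination h6
    subst hA
    have hB : B = 0 := by linear_combination e3/4
    subst hB
    have h7 : (2*(0 + h^2) - 1) * (1 - h^2 - 0) = 0 := by linear_combination -e4/2
    exact (mul_ne_zero hb' hne') h7
  · have hB : B = h^2-1 := by linear_combination -h6
    subst hB
    have h7 : (2*(A + h^2) - 1) * (A - (h^2-1)) = 0 := by linear_combination -e3/2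
    exact (mul_ne_zero ha' hne') h7

/-- A vector orthogonal to itself and to three vectors of an irreducible triple is zero. -/
theorem orth_zero (h p q r p1 q1 r1 p2 q2 r2 p3 q3 r3 : ℂ)
    (hirr : IsIrreducibleFamily ![M h p1 q1 r1, M h p2 q2 r2, M h p3 q3 r3])
    (h0 : p * p + q * r = 0)
    (h1 : 2 * p * p1 + q * r1 + r * q1 = 0)
    (h2 : 2 * p * p2 + q * r2 + r * q2 = 0)
    (h3 : 2 * p * p3 + q * r3 + r * q3 = 0) : p = 0 ∧ q = 0 ∧ r = 0 := by
  by_cases hq : q = 0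
  · subst hq
    have hp : p = 0 := by
      have : p * p = 0 := by linear_combination h0
      simpa using this
    subst hp
    refine ⟨rfl, rfl, ?_⟩
    by_contra hr
    apply hirr
    have g1 : q1 = 0 := by
      have : r * q1 = 0 := by linear_combination h1
      exact (mul_eq_zero.mp this).resolve_left hr
    have g2 : q2 = 0 := by
      have : r * q2 = 0 := by linear_combination h2
      exact (mul_eq_zero.mp this).resolve_left hr
    have g3 : q3 = 0 := by
      have : r * q3 = 0 := by linear_combination h3
      exact (mul_eq_zero.mp this).resolve_left hr
    subst g1 g2 g3
    refine ⟨![0, 1], fun hv => one_ne_zero (congrFun hv 1), fun i => ?_⟩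
    have key : ∀ P R : ℂ, ∃ a : ℂ, (M h P 0 R).mulVec ![0, 1] = a • ![0, 1] := fun P R =>
      ⟨h - P, by ext j; fin_cases j <;> simp [M, Matrix.mulVec, dotProduct, Fin.sum_univ_two]⟩
    fin_cases i
    · exact key _ _
    · exact key _ _
    · exact key _ _
  · exfalso
    apply hirr
    refine ⟨![q, -p], fun hv => hq (congrFun hv 0), fun i => ?_⟩
    have key : ∀ P Q R : ℂ, 2 * p * P + q * R + r * Q = 0 →
        ∃ a : ℂ, (M h P Q R).mulVec ![q, -p] = a • ![q, -p] := by
      intro P Q R hh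
      refine ⟨h + (P * q - Q * p) / q, ?_⟩
      ext j
      fin_cases j
      · simp [M, Matrix.mulVec, dotProduct, Fin.sum_univ_two]
        field_simp
        ring
      · simp [M, Matrix.mulVec, dotProduct, Fin.sum_univ_two]
        field_simp
        linear_combination q * hh - Q * h0
    fin_cases i
    · exact key _ _ _ h1
    · exact key _ _ _ h2
    · exact key _ _ _ h3

/-- One of the four eigenvalues of the Gram matrix vanishes. -/
theorem eig_zero (d A B C p1 q1 r1 p2 q2 r2 p3 q3 r3 p4 q4 r4 : ℂ)
    (g11 : p1 * p1 + q1 * r1 = d) (g22 : p2 * p2 + q2 * r2 = d)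
    (g33 : p3 * p3 + q3 * r3 = d) (g44 : p4 * p4 + q4 * r4 = d)
    (g12 : p1 * p2 + (q1 * r2 + r1 * q2) / 2 = A) (g34 : p3 * p4 + (q3 * r4 + r3 * q4) / 2 = A)
    (g23 : p2 * p3 + (q2 * r3 + r2 * q3) / 2 = B) (g14 : p1 * p4 + (q1 * r4 + r1 * q4) / 2 = B)
    (g13 : p1 * p3 + (q1 * r3 + r1 * q3) / 2 = C) (g24 : p2 * p4 + (q2 * r4 + r2 * q4) / 2 = C) :
    d + A + B + C = 0 ∨ d + A - B - C = 0 ∨ d - A + B - C = 0 ∨ d - A - B + C = 0 := by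
  have hdet : (!![p1, p2, p3, p4; q1, q2, q3, q4; r1, r2, r3, r4; 0, 0, 0, 0] :
      Matrix (Fin 4) (Fin 4) ℂ).det = 0 :=
    Matrix.det_eq_zero_of_row_eq_zero 3 (by intro j; fin_cases j <;> rfl)
  obtain ⟨c, hc, hc0⟩ := Matrix.exists_mulVec_eq_zero_iff.mpr hdet
  have k0 := congrFun hc0 0
  have k1 := congrFun hc0 1
  have k2 := congrFun hc0 2
  simp [Matrix.mulVec, dotProduct, Fin.sum_univ_four] at k0 k1 k2
  have m1 : d * c 0 + A * c 1 + C * c 2 + B * c 3 = 0 := by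
    rw [← g11, ← g12, ← g13, ← g14]; linear_combination p1 * k0 + r1 / 2 * k1 + q1 / 2 * k2
  have m2 : A * c 0 + d * c 1 + B * c 2 + C * c 3 = 0 := by
    rw [← g22, ← g12, ← g23, ← g24]; linear_combination p2 * k0 + r2 / 2 * k1 + q2 / 2 * k2
  have m3 : C * c 0 + B * c 1 + d * c 2 + A * c 3 = 0 := by
    rw [← g33, ← g34, ← g23, ← g13]; linear_combination p3 * k0 + r3 / 2 * k1 + q3 / 2 * k2
  have m4 : B * c 0 + C * c 1 + A * c 2 + d * c 3 = 0 := by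
    rw [← g44, ← g34, ← g14, ← g24]; linear_combination p4 * k0 + r4 / 2 * k1 + q4 / 2 * k2
  by_contra hcon
  push Not at hcon
  obtain ⟨n1, n2, n3, n4⟩ := hcon
  have l1 : c 0 + c 1 + c 2 + c 3 = 0 := (mul_eq_zero.mp (show (d + A + B + C) * _ = 0 by
    linear_combination m1 + m2 + m3 + m4)).resolve_left n1
  have l2 : c 0 + c 1 - c 2 - c 3 = 0 := (mul_eq_zero.mp (show (d + A - B - C) * _ = 0 by
    linear_combination m1 + m2 - m3 - m4)).resolve_left n2
  have l3 : c 0 - c 1 - c 2 + c 3 = 0 := (mul_eq_zero.mp (show (d - A + B - C) * _ = 0 by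
    linear_combination m1 - m2 - m3 + m4)).resolve_left n3
  have l4 : c 0 - c 1 + c 2 - c 3 = 0 := (mul_eq_zero.mp (show (d - A - B + C) * _ = 0 by
    linear_combination m1 - m2 + m3 - m4)).resolve_left n4
  apply hc
  ext j
  fin_cases j
  · show c 0 = 0
    linear_combination (l1 + l2 + l3 + l4) / 4
  · show c 1 = 0
    linear_combination (l1 + l2 - l3 - l4) / 4
  · show c 2 = 0
    linear_combination (l1 - l2 - l3 + l4) / 4
  · show c 3 = 0
    linear_combination (l1 - l2 + l3 - l4) / 4

theorem core_s17 (h A B C p1 q1 r1 p2 q2 r2 p3 q3 r3 p4 q4 r4 : ℂ)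
    (hirr : IsIrreducibleFamily ![M h p1 q1 r1, M h p2 q2 r2, M h p3 q3 r3])
    (g11 : p1 * p1 + q1 * r1 = h^2-1) (g22 : p2 * p2 + q2 * r2 = h^2-1)
    (g33 : p3 * p3 + q3 * r3 = h^2-1) (g44 : p4 * p4 + q4 * r4 = h^2-1)
    (g12 : p1 * p2 + (q1 * r2 + r1 * q2) / 2 = A) (g34 : p3 * p4 + (q3 * r4 + r3 * q4) / 2 = A)
    (g23 : p2 * p3 + (q2 * r3 + r2 * q3) / 2 = B) (g14 : p1 * p4 + (q1 * r4 + r1 * q4) / 2 = B)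
    (g13 : p1 * p3 + (q1 * r3 + r1 * q3) / 2 = C) (g24 : p2 * p4 + (q2 * r4 + r2 * q4) / 2 = C)
    (ha : 2 * (A + h^2) ≠ 1) (hb : 2 * (B + h^2) ≠ 1)
    (hD1 : M h p1 q1 r1 * M h p2 q2 r2 * adjugate (M h p1 q1 r1) * M h p4 q4 r4 * M h p1 q1 r1
      = M h p2 q2 r2 * M h p3 q3 r3 * adjugate (M h p2 q2 r2) * M h p1 q1 r1 * M h p2 q2 r2)
    (hD2 : M h p2 q2 r2 * M h p3 q3 r3 * adjugate (M h p2 q2 r2) * M h p1 q1 r1 * M h p2 q2 r2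
      = M h p3 q3 r3 * M h p4 q4 r4 * adjugate (M h p3 q3 r3) * M h p2 q2 r2 * M h p3 q3 r3)
    (hD3 : M h p3 q3 r3 * M h p4 q4 r4 * adjugate (M h p3 q3 r3) * M h p2 q2 r2 * M h p3 q3 r3
      = M h p4 q4 r4 * M h p1 q1 r1 * adjugate (M h p4 q4 r4) * M h p3 q3 r3 * M h p4 q4 r4) :
    A = B := by
  have hG : Gram p1 q1 r1 p2 q2 r2 p3 q3 r3 (h^2-1) (h^2-1) (h^2-1) A B C _ :=
    ⟨g11.symm, g22.symm, g33.symm, g12.symm, g23.symm, g13.symm, rfl⟩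
  rcases eig_zero (h^2-1) A B C p1 q1 r1 p2 q2 r2 p3 q3 r3 p4 q4 r4
    g11 g22 g33 g44 g12 g34 g23 g14 g13 g24 with hE | hE | hE | hE
  · obtain ⟨a1, a2, a3⟩ := orth_zero h (p1+p2+p3+p4) (q1+q2+q3+q4) (r1+r2+r3+r4) _ _ _ _ _ _ _ _ _ hirr
      (by linear_combination 4 * hE + g11 + g22 + g33 + g44 + 2 * (g12 + g34 + g23 + g14 + g13 + g24))
      (by linear_combination 2 * hE + 2 * (g11 + g12 + g13 + g14))
      (by linear_combination 2 * hE + 2 * (g22 + g12 + g23 + g24))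
      (by linear_combination 2 * hE + 2 * (g33 + g34 + g23 + g13))
    have b1 : p4 = -p1-p2-p3 := by linear_combination a1
    have b2 : q4 = -q1-q2-q3 := by linear_combination a2
    have b3 : r4 = -r1-r2-r3 := by linear_combination a3
    subst b1 b2 b3
    exact case_sum h _ _ _ _ _ _ _ _ _ A B C _ hG (by linear_combination hE) ha hb hD1 hD2
  · obtain ⟨a1, a2, a3⟩ := orth_zero h (p1+p2-p3-p4) (q1+q2-q3-q4) (r1+r2-r3-r4) _ _ _ _ _ _ _ _ _ hirr
      (by linear_combination 4 * hE + g11 + g22 + g33 + g44 + 2 * (g12 + g34 - g23 - g14 - g13 - g24))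
      (by linear_combination 2 * hE + 2 * (g11 + g12 - g13 - g14))
      (by linear_combination 2 * hE + 2 * (g22 + g12 - g23 - g24))
      (by linear_combination -2 * hE + 2 * (-g33 - g34 + g23 + g13))
    have b1 : p4 = p1+p2-p3 := by linear_combination -a1
    have b2 : q4 = q1+q2-q3 := by linear_combination -a2
    have b3 : r4 = r1+r2-r3 := by linear_combination -a3
    subst b1 b2 b3
    exact case_12 h _ _ _ _ _ _ _ _ _ A B C _ hG (by linear_combination -hE) ha hb hD1 hD2
  · obtain ⟨a1, a2, a3⟩ := orth_zero h (p1-p2-p3+p4) (q1-q2-q3+q4) (r1-r2-r3+r4) _ _ _ _ _ _ _ _ _ hirr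
      (by linear_combination 4 * hE + g11 + g22 + g33 + g44 + 2 * (-g12 - g34 + g23 + g14 - g13 - g24))
      (by linear_combination 2 * hE + 2 * (g11 - g12 - g13 + g14))
      (by linear_combination -2 * hE + 2 * (-g22 + g12 - g23 + g24))
      (by linear_combination -2 * hE + 2 * (-g33 + g34 - g23 + g13))
    have b1 : p1 = p2+p3-p4 := by linear_combination a1
    have b2 : q1 = q2+q3-q4 := by linear_combination a2
    have b3 : r1 = r2+r3-r4 := by linear_combination a3
    have hG' : Gram p2 q2 r2 p3 q3 r3 p4 q4 r4 (h^2-1) (h^2-1) (h^2-1) B A C _ :=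
      ⟨g22.symm, g33.symm, g44.symm, g23.symm, g34.symm, g24.symm, rfl⟩
    subst b1 b2 b3
    exact (case_12 h _ _ _ _ _ _ _ _ _ B A C _ hG' (by linear_combination -hE) hb ha hD2 hD3).symm
  · obtain ⟨a1, a2, a3⟩ := orth_zero h (p1-p2+p3-p4) (q1-q2+q3-q4) (r1-r2+r3-r4) _ _ _ _ _ _ _ _ _ hirr
      (by linear_combination 4 * hE + g11 + g22 + g33 + g44 + 2 * (-g12 - g34 - g23 - g14 + g13 + g24))
      (by linear_combination 2 * hE + 2 * (g11 - g12 + g13 - g14))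
      (by linear_combination -2 * hE + 2 * (-g22 + g12 + g23 - g24))
      (by linear_combination 2 * hE + 2 * (g33 - g34 - g23 + g13))
    have b1 : p4 = p1+p3-p2 := by linear_combination -a1
    have b2 : q4 = q1+q3-q2 := by linear_combination -a2
    have b3 : r4 = r1+r3-r2 := by linear_combination -a3
    subst b1 b2 b3
    exact case_13 h _ _ _ _ _ _ _ _ _ A B C _ hG (by linear_combination hE) ha hb hD1 hD2

/-- Normal form of an element of `SL(2, ℂ)` of trace `t`. -/
theorem exists_M (t : ℂ) (x : Matrix.SpecialLinearGroup (Fin 2) ℂ)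
    (hx : (x : Matrix (Fin 2) (Fin 2) ℂ).trace = t) :
    ∃ p q r : ℂ, (x : Matrix (Fin 2) (Fin 2) ℂ) = M (t/2) p q r ∧ p * p + q * r = (t/2)^2 - 1 := by
  have hd := x.det_coe
  rw [Matrix.det_fin_two] at hd
  rw [Matrix.trace_fin_two] at hx
  refine ⟨(x : Matrix (Fin 2) (Fin 2) ℂ) 0 0 - t/2, (x : Matrix (Fin 2) (Fin 2) ℂ) 0 1,
    (x : Matrix (Fin 2) (Fin 2) ℂ) 1 0, ?_, ?_⟩
  · ext i j
    fin_cases i <;> fin_cases j <;> simp [M]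
    linear_combination hx
  · linear_combination -hd + (x : Matrix (Fin 2) (Fin 2) ℂ) 0 0 * hx

theorem trace_MM (h p1 q1 r1 p2 q2 r2 : ℂ) :
    (M h p1 q1 r1 * M h p2 q2 r2).trace = 2 * (p1 * p2 + (q1 * r2 + r1 * q2) / 2 + h^2) := by
  simp only [M, Matrix.mul_fin_two, Matrix.trace_fin_two_of]
  ring

/-- Under the trace equations of 8₁₈ with all triples irreducible,
`tr(xᵢxᵢ₊₁) ≠ 1`, `tr(x₁x₃) = tr(x₂x₄)`, `tr(x₁x₄) = tr(x₂x₃)` and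
`tr(x₁x₂) = tr(x₃x₄)`, one has `tr(x₁x₂) = tr(x₂x₃)`. -/
theorem stmt17 (t : ℂ) (x₁ x₂ x₃ x₄ : SL2)
    (hx₁ : ((x₁ : 𝕄)).trace = t) (hx₂ : ((x₂ : 𝕄)).trace = t)
    (hx₃ : ((x₃ : 𝕄)).trace = t) (hx₄ : ((x₄ : 𝕄)).trace = t)
    (hr₁₂ : x₁ * x₂ * x₁⁻¹ * x₄ * x₁ = x₂ * x₃ * x₂⁻¹ * x₁ * x₂)
    (hr₂₃ : x₂ * x₃ * x₂⁻¹ * x₁ * x₂ = x₃ * x₄ * x₃⁻¹ * x₂ * x₃)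
    (hr₃₄ : x₃ * x₄ * x₃⁻¹ * x₂ * x₃ = x₄ * x₁ * x₄⁻¹ * x₃ * x₄)
    (hirr₁₂₃ : IsIrreducibleFamily ![(x₁ : 𝕄), (x₂ : 𝕄), (x₃ : 𝕄)])
    (hirr₁₂₄ : IsIrreducibleFamily ![(x₁ : 𝕄), (x₂ : 𝕄), (x₄ : 𝕄)])
    (hirr₁₃₄ : IsIrreducibleFamily ![(x₁ : 𝕄), (x₃ : 𝕄), (x₄ : 𝕄)])
    (hirr₂₃₄ : IsIrreducibleFamily ![(x₂ : 𝕄), (x₃ : 𝕄), (x₄ : 𝕄)])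
    (ht₁₂ : ((x₁ * x₂ : SL2) : 𝕄).trace ≠ 1) (ht₂₃ : ((x₂ * x₃ : SL2) : 𝕄).trace ≠ 1)
    (ht₃₄ : ((x₃ * x₄ : SL2) : 𝕄).trace ≠ 1) (ht₄₁ : ((x₄ * x₁ : SL2) : 𝕄).trace ≠ 1)
    (h1324 : ((x₁ * x₃ : SL2) : 𝕄).trace = ((x₂ * x₄ : SL2) : 𝕄).trace)
    (h1423 : ((x₁ * x₄ : SL2) : 𝕄).trace = ((x₂ * x₃ : SL2) : 𝕄).trace)
    (h1234 : ((x₁ * x₂ : SL2) : 𝕄).trace = ((x₃ * x₄ : SL2) : 𝕄).trace) :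
    ((x₁ * x₂ : SL2) : 𝕄).trace = ((x₂ * x₃ : SL2) : 𝕄).trace := by
  obtain ⟨p1, q1, r1, e1, g1⟩ := exists_M t x₁ hx₁
  obtain ⟨p2, q2, r2, e2, g2⟩ := exists_M t x₂ hx₂
  obtain ⟨p3, q3, r3, e3, g3⟩ := exists_M t x₃ hx₃
  obtain ⟨p4, q4, r4, e4, g4⟩ := exists_M t x₄ hx₄
  have hD1 := congrArg (fun z : SL2 => (z : 𝕄)) hr₁₂
  have hD2 := congrArg (fun z : SL2 => (z : 𝕄)) hr₂₃
  have hD3 := congrArg (fun z : SL2 => (z : 𝕄)) hr₃₄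
  simp only [Matrix.SpecialLinearGroup.coe_mul, Matrix.SpecialLinearGroup.coe_inv,
    e1, e2, e3, e4] at hD1 hD2 hD3
  simp only [Matrix.SpecialLinearGroup.coe_mul, e1, e2, e3, e4, trace_MM] at *
  have key := core_s17 (t/2) _ _ _ p1 q1 r1 p2 q2 r2 p3 q3 r3 p4 q4 r4 hirr₁₂₃ g1 g2 g3 g4
    rfl (by linear_combination -h1234 / 2) rfl (by linear_combination h1423 / 2)
    rfl (by linear_combination -h1324 / 2) ht₁₂ ht₂₃ hD1 hD2 hD3
  rw [key]
end
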